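/- arXiv:2107.00787 — 2 statements merged into one kernel-verified Lean document; each statement's English description precedes it below -/
import Mathlib

section
/- Let a and b be nonnegative integers, not both zero, with a + b even. There exists a rational constant C (depending only on a and b) such that N*(a,b; 8n+a+3b) = C · N(a,b; 8n+a+3b) holds for every nonnegative integer n if and only if (a,b) belongs to the set S = {(0,2), (0,4), (0,6), (1,1), (1,3), (2,0), (3,1), (4,0), (6,0)}. -/
/-- `N a b n` is the number of tuples `(x₁,…,x_a,y₁,…,y_b) ∈ ℤ^{a+b}` with
`n = x₁² + ⋯ + x_a² + 3y₁² + ⋯ + 3y_b²`. -/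
noncomputable def N (a b : ℕ) (n : ℤ) : ℕ :=
  Set.ncard {p : (Fin a → ℤ) × (Fin b → ℤ) |
    n = ∑ i, (p.1 i) ^ 2 + 3 * ∑ j, (p.2 j) ^ 2}

/-- `Nstar a b n` is the number of such tuples with all coordinates odd. -/
noncomputable def Nstar (a b : ℕ) (n : ℤ) : ℕ :=
  Set.ncard {p : (Fin a → ℤ) × (Fin b → ℤ) |
    (∀ i, Odd (p.1 i)) ∧ (∀ j, Odd (p.2 j)) ∧
    n = ∑ i, (p.1 i) ^ 2 + 3 * ∑ j, (p.2 j) ^ 2}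

/-- The integer solutions of `∑ i, c i * v i ^ 2 = n`. -/
def diagSols {ι : Type*} [Fintype ι] (c : ι → ℕ) (n : ℤ) : Set (ι → ℤ) :=
  {v | ∑ i, (c i : ℤ) * v i ^ 2 = n}

/-- The solutions of `∑ i, c i * v i ^ 2 = n` whose set of even coordinates is exactly `T`. -/
def diagSolsEvenOn {ι : Type*} [Fintype ι] (c : ι → ℕ) (n : ℤ) (T : Finset ι) : Set (ι → ℤ) :=
  {v | (∀ i, Even (v i) ↔ i ∈ T) ∧ ∑ i, (c i : ℤ) * v i ^ 2 = n}

lemma finite_diagSols {ι : Type*} [Fintype ι] {c : ι → ℕ} (hc : ∀ i, 0 < c i) (n : ℤ) :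
    (diagSols c n).Finite := by
  refine (Set.Finite.pi' (fun _ : ι => Set.finite_Icc (-n) n)).subset ?_
  intro v hv i
  have h1 : (c i : ℤ) * v i ^ 2 ≤ n := by
    rw [← show _ = n from hv]
    exact Finset.single_le_sum (f := fun i => (c i : ℤ) * v i ^ 2)
      (fun i _ => by positivity) (Finset.mem_univ i)
  have h2 : (1 : ℤ) ≤ c i := by exact_mod_cast hc i
  have h3 : v i ^ 2 ≤ n := by nlinarith [sq_nonneg (v i)]
  constructor <;> nlinarith [sq_nonneg (v i - 1), sq_nonneg (v i + 1), sq_nonneg (v i)]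

lemma modEq_eight_sum_sq_of_odd {ι : Type*} {c : ι → ℕ} {T : Finset ι} {v : ι → ℤ}
    (hv : ∀ i ∈ T, Odd (v i)) :
    ∑ i ∈ T, (c i : ℤ) * v i ^ 2 ≡ ∑ i ∈ T, (c i : ℤ) [ZMOD 8] := by
  refine Int.ModEq.sum fun i hi => ?_
  have h8 : v i ^ 2 ≡ 1 [ZMOD 8] := by
    obtain ⟨k, hk⟩ := hv i hi
    obtain ⟨l, hl⟩ := Int.even_mul_succ_self k
    rw [show v i ^ 2 = 8 * l + 1 by rw [hk]; linear_combination 4 * hl]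
    simp [Int.ModEq]
  simpa using h8.mul_left (c i : ℤ)

section Reflection

variable {ι : Type*} [DecidableEq ι]

/-- For weights `c` of total `4` on `T`, the negative of the reflection in the all-ones
vector supported on `T`. -/
def negReflect (c : ι → ℕ) (T : Finset ι) (v : ι → ℤ) : ι → ℤ :=
  fun i => if i ∈ T then (∑ j ∈ T, (c j : ℤ) * v j) / 2 - v i else v i

lemma sum_negReflect {c : ι → ℕ} {T : Finset ι} (hT : ∑ i ∈ T, c i = 4) {v : ι → ℤ}
    (hv : Even (∑ j ∈ T, (c j : ℤ) * v j)) :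
    ∑ j ∈ T, (c j : ℤ) * negReflect c T v j = ∑ j ∈ T, (c j : ℤ) * v j := by
  obtain ⟨s, hs⟩ := hv
  have hT' : ∑ i ∈ T, (c i : ℤ) = 4 := by exact_mod_cast hT
  have : ∑ j ∈ T, (c j : ℤ) * negReflect c T v j
      = ∑ j ∈ T, ((c j : ℤ) * s - (c j : ℤ) * v j) := by
    refine Finset.sum_congr rfl fun j hj => ?_
    simp only [negReflect, if_pos hj, hs]
    rw [show (s + s) / 2 = s by omega]; ring
  rw [this, Finset.sum_sub_distrib, ← Finset.sum_mul, hT', hs]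
  ring

lemma negReflect_negReflect {c : ι → ℕ} {T : Finset ι} (hT : ∑ i ∈ T, c i = 4) {v : ι → ℤ}
    (hv : Even (∑ j ∈ T, (c j : ℤ) * v j)) :
    negReflect c T (negReflect c T v) = v := by
  funext i
  have := sum_negReflect hT hv
  by_cases hi : i ∈ T
  · rw [negReflect, if_pos hi, this, negReflect, if_pos hi]; ring
  · simp [negReflect, hi]

variable [Fintype ι]

lemma sum_sq_negReflect {c : ι → ℕ} {T : Finset ι} (hT : ∑ i ∈ T, c i = 4) {v : ι → ℤ}
    (hv : Even (∑ j ∈ T, (c j : ℤ) * v j)) :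
    ∑ i, (c i : ℤ) * negReflect c T v i ^ 2 = ∑ i, (c i : ℤ) * v i ^ 2 := by
  obtain ⟨s, hs⟩ := hv
  have hT' : ∑ i ∈ T, (c i : ℤ) = 4 := by exact_mod_cast hT
  rw [← Finset.sum_add_sum_compl T, ← Finset.sum_add_sum_compl T]
  congr 1
  · have : ∑ j ∈ T, (c j : ℤ) * negReflect c T v j ^ 2
        = ∑ j ∈ T, ((c j : ℤ) * s ^ 2 - 2 * s * ((c j : ℤ) * v j) + (c j : ℤ) * v j ^ 2) := by
      refine Finset.sum_congr rfl fun j hj => ?_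
      simp only [negReflect, if_pos hj, hs]
      rw [show (s + s) / 2 = s by omega]; ring
    rw [this, Finset.sum_add_distrib, Finset.sum_sub_distrib, ← Finset.sum_mul, ← Finset.mul_sum,
      hT', hs]
    ring
  · refine Finset.sum_congr rfl fun j hj => ?_
    simp [negReflect, Finset.mem_compl.1 hj]

/-- A solution has weighted square sum over its even coordinates congruent to
the sum of weights there. -/
lemma modEq_eight_of_mem_diagSolsEvenOn {c : ι → ℕ} {n : ℤ} (hn : n ≡ ∑ i, (c i : ℤ) [ZMOD 8])
    {T : Finset ι} {v : ι → ℤ} (hv : v ∈ diagSolsEvenOn c n T) :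
    ∑ i ∈ T, (c i : ℤ) * v i ^ 2 ≡ ∑ i ∈ T, (c i : ℤ) [ZMOD 8] := by
  obtain ⟨hv1, hv2⟩ := hv
  have h1 : ∑ i ∈ Tᶜ, (c i : ℤ) * v i ^ 2 ≡ ∑ i ∈ Tᶜ, (c i : ℤ) [ZMOD 8] :=
    modEq_eight_sum_sq_of_odd fun i hi => by
      rw [← Int.not_even_iff_odd, hv1]; exact Finset.mem_compl.1 hi
  rw [← hv2, ← Finset.sum_add_sum_compl T, ← Finset.sum_add_sum_compl T] at hn
  exact Int.ModEq.add_right_cancel h1 hn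

lemma four_dvd_of_mem_diagSolsEvenOn {c : ι → ℕ} {n : ℤ} (hn : n ≡ ∑ i, (c i : ℤ) [ZMOD 8])
    {T : Finset ι} {v : ι → ℤ} (hv : v ∈ diagSolsEvenOn c n T) : 4 ∣ ∑ i ∈ T, c i := by
  have h := modEq_eight_of_mem_diagSolsEvenOn hn hv
  have h4 : (4 : ℤ) ∣ ∑ i ∈ T, (c i : ℤ) * v i ^ 2 := by
    refine Finset.dvd_sum fun i hi => Dvd.dvd.mul_left ?_ _
    obtain ⟨k, hk⟩ := (hv.1 i).2 hi
    exact ⟨k ^ 2, by rw [hk]; ring⟩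
  have : (4 : ℤ) ∣ ∑ i ∈ T, (c i : ℤ) := by
    have := h.dvd
    omega
  exact_mod_cast this

/-- Reflection matches solutions that are even exactly on `T` with the odd solutions whose
weighted sum over `T` is `2` modulo `4`. -/
lemma ncard_diagSolsEvenOn_eq {c : ι → ℕ} {n : ℤ}
    (hn : n ≡ ∑ i, (c i : ℤ) [ZMOD 8]) {T : Finset ι} (hT : ∑ i ∈ T, c i = 4) :
    (diagSolsEvenOn c n T).ncard
      = {v ∈ diagSolsEvenOn c n ∅ | (∑ j ∈ T, (c j : ℤ) * v j) % 4 = 2}.ncard := by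
  have hT' : ∑ i ∈ T, (c i : ℤ) = 4 := by exact_mod_cast hT
  have key : ∀ v ∈ diagSolsEvenOn c n T, (∑ j ∈ T, (c j : ℤ) * v j) % 4 = 2 := by
    intro v hv
    have h := modEq_eight_of_mem_diagSolsEvenOn hn hv
    have hdiv : ∀ i ∈ T, v i = 2 * (v i / 2) := fun i hi => by
      have := (hv.1 i).2 hi
      rw [Int.even_iff] at this; omega
    have h1 : ∑ i ∈ T, (c i : ℤ) * v i ^ 2 = 4 * ∑ i ∈ T, (c i : ℤ) * (v i / 2) ^ 2 := by
      rw [Finset.mul_sum]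
      refine Finset.sum_congr rfl fun i hi => ?_
      conv_lhs => rw [hdiv i hi]
      ring
    have h2 : ∑ i ∈ T, (c i : ℤ) * v i = 2 * ∑ i ∈ T, (c i : ℤ) * (v i / 2) := by
      rw [Finset.mul_sum]
      refine Finset.sum_congr rfl fun i hi => ?_
      conv_lhs => rw [hdiv i hi]
      ring
    have h3 : ∑ i ∈ T, (c i : ℤ) * (v i / 2) ^ 2 ≡ ∑ i ∈ T, (c i : ℤ) * (v i / 2) [ZMOD 2] := by
      refine Int.ModEq.sum fun i _ => Int.ModEq.mul_left _ ?_
      rcases Int.emod_two_eq_zero_or_one (v i / 2) with h | h <;> simp [Int.ModEq, pow_two, Int.mul_emod, h]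
    rw [h1, hT'] at h
    rw [h2]
    simp only [Int.ModEq] at h h3
    omega
  refine Set.BijOn.ncard_eq (f := negReflect c T) (Set.InvOn.bijOn (f' := negReflect c T) ⟨?_, ?_⟩ ?_ ?_)
  · intro v hv
    exact negReflect_negReflect hT (by rw [Int.even_iff]; have := key v hv; omega)
  · intro v hv
    exact negReflect_negReflect hT (by rw [Int.even_iff]; have := hv.2; omega)
  · intro v hv
    have hk := key v hv
    have he : Even (∑ j ∈ T, (c j : ℤ) * v j) := by rw [Int.even_iff]; omega
    refine ⟨⟨fun i => ?_, (sum_sq_negReflect hT he).trans hv.2⟩, by rwa [sum_negReflect hT he]⟩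
    have := hv.1 i
    by_cases hi : i ∈ T
    · simp only [negReflect, hi, if_true, iff_true, Int.even_iff] at this ⊢
      simp
      omega
    · simpa [negReflect, hi] using this
  · rintro v ⟨hv, hk⟩
    have he : Even (∑ j ∈ T, (c j : ℤ) * v j) := by rw [Int.even_iff]; omega
    refine ⟨fun i => ?_, (sum_sq_negReflect hT he).trans hv.2⟩
    have := hv.1 i
    by_cases hi : i ∈ T
    · simp [Int.even_iff] at this
      simp only [negReflect, hi, if_true, iff_true, Int.even_iff] at this ⊢
      omega
    · simpa [negReflect, hi] using this

/-- Changing the sign of one coordinate in `T` exchanges the two classes modulo `4` of odd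
solutions. -/
lemma ncard_diagSols_odd_eq_two_mul {c : ι → ℕ} (hc : ∀ i, 0 < c i) (hodd : ∀ i, Odd (c i))
    {n : ℤ} {T : Finset ι} (hT : ∑ i ∈ T, c i = 4) :
    (diagSolsEvenOn c n ∅).ncard
      = 2 * {v ∈ diagSolsEvenOn c n ∅ | (∑ j ∈ T, (c j : ℤ) * v j) % 4 = 2}.ncard := by
  have hT' : ∑ i ∈ T, (c i : ℤ) = 4 := by exact_mod_cast hT
  obtain ⟨k, hk⟩ : T.Nonempty := by
    rw [Finset.nonempty_iff_ne_empty]; rintro rfl; simp at hT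
  have hfin : (diagSolsEvenOn c n ∅).Finite := (finite_diagSols hc n).subset fun v hv => hv.2
  set A := {v ∈ diagSolsEvenOn c n ∅ | (∑ j ∈ T, (c j : ℤ) * v j) % 4 = 2} with hA
  set B := {v ∈ diagSolsEvenOn c n ∅ | (∑ j ∈ T, (c j : ℤ) * v j) % 4 = 0} with hB
  have heven : ∀ v ∈ diagSolsEvenOn c n ∅, (∑ j ∈ T, (c j : ℤ) * v j) % 2 = 0 := by
    intro v hv
    have : ∑ j ∈ T, (c j : ℤ) * v j ≡ ∑ j ∈ T, (c j : ℤ) [ZMOD 2] := by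
      refine Int.ModEq.sum fun i _ => ?_
      have h1 : v i ≡ 1 [ZMOD 2] := by
        have := hv.1 i
        simpa [Int.even_iff, Int.ModEq] using this
      simpa using h1.mul_left (c i : ℤ)
    rw [hT'] at this
    simpa [Int.ModEq] using this
  have hunion : diagSolsEvenOn c n ∅ = A ∪ B := by
    ext v
    simp only [hA, hB, Set.mem_union, Set.mem_ofPred_eq, ← and_or_left]
    refine ⟨fun hv => ⟨hv, ?_⟩, fun hv => hv.1⟩
    have := heven v hv
    omega
  have hdisj : Disjoint A B := by
    rw [Set.disjoint_left]
    rintro v ⟨-, h1⟩ ⟨-, h2⟩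
    omega
  have hflip : ∀ v : ι → ℤ, ∑ j ∈ T, (c j : ℤ) * Function.update v k (-v k) j
      = ∑ j ∈ T, (c j : ℤ) * v j - 2 * (c k * v k) := by
    intro v
    rw [← Finset.add_sum_erase _ _ hk, ← Finset.add_sum_erase T (fun j => (c j : ℤ) * v j) hk,
      Finset.sum_congr rfl fun j hj => by
        rw [Function.update_of_ne (Finset.ne_of_mem_erase hj)]]
    simp; ring
  have hmem : ∀ v ∈ diagSolsEvenOn c n ∅,
      Function.update v k (-v k) ∈ diagSolsEvenOn c n ∅ := by
    rintro v ⟨hv1, hv2⟩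
    refine ⟨fun i => ?_, ?_⟩
    · by_cases hi : i = k
      · subst hi; simpa using hv1 i
      · simpa [hi] using hv1 i
    · rw [← hv2]
      refine Finset.sum_congr rfl fun i _ => ?_
      by_cases hi : i = k
      · subst hi; simp
      · simp [hi]
  have hck : ∀ v ∈ diagSolsEvenOn c n ∅, ((c k : ℤ) * v k) % 2 = 1 := by
    intro v hv
    rw [← Int.odd_iff, Int.odd_mul]
    refine ⟨by exact_mod_cast hodd k, ?_⟩
    simpa using hv.1 k
  have hinv : ∀ v : ι → ℤ, Function.update (Function.update v k (-v k)) k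
      (-(Function.update v k (-v k)) k) = v := by intro v; simp
  have hAB : A.ncard = B.ncard := by
    refine Set.BijOn.ncard_eq (f := fun v => Function.update v k (-v k))
      (Set.InvOn.bijOn (f' := fun v => Function.update v k (-v k))
        ⟨fun v _ => hinv v, fun v _ => hinv v⟩ ?_ ?_)
    · rintro v ⟨hv, h⟩
      refine ⟨hmem v hv, ?_⟩
      simp only [hflip]
      have := hck v hv
      omega
    · rintro v ⟨hv, h⟩
      refine ⟨hmem v hv, ?_⟩
      simp only [hflip]
      have := hck v hv
      omega
  conv_lhs => rw [hunion, Set.ncard_union_eq hdisj (hfin.subset fun v hv => hv.1)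
    (hfin.subset fun v hv => hv.1), ← hAB]
  ring

theorem exists_ncard_odd_eq_mul {c : ι → ℕ} (hc : ∀ i, 0 < c i) (hodd : ∀ i, Odd (c i))
    (h4 : ∀ T : Finset ι, 4 ∣ ∑ i ∈ T, c i → ∑ i ∈ T, c i = 0 ∨ ∑ i ∈ T, c i = 4) :
    ∃ C : ℚ, ∀ n : ℤ, n ≡ ∑ i, (c i : ℤ) [ZMOD 8] →
      ((diagSolsEvenOn c n ∅).ncard : ℚ) = C * (diagSols c n).ncard := by
  classical
  set 𝒯 := (Finset.univ : Finset (Finset ι)).filter fun T => ∑ i ∈ T, c i = 4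
  refine ⟨2 / (2 + 𝒯.card), fun n hn => ?_⟩
  have hfin := finite_diagSols hc n
  let ev : (ι → ℤ) → Finset ι := fun v => Finset.univ.filter fun i => Even (v i)
  have hev : ∀ v T, ev v = T ↔ ∀ i, Even (v i) ↔ i ∈ T := by
    intro v T; simp [ev, Finset.ext_iff]
  have hfib : ∀ T, (hfin.toFinset.filter fun v => ev v = T).card
      = (diagSolsEvenOn c n T).ncard := by
    intro T
    rw [← Set.ncard_coe_finset]
    congr 1
    ext v
    simp [diagSolsEvenOn, diagSols, hev, and_comm]
  have hempty : ∅ ∉ 𝒯 := by simp [𝒯]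
  have hmaps : Set.MapsTo ev (hfin.toFinset : Set (ι → ℤ)) (insert ∅ 𝒯 : Finset (Finset ι)) := by
    intro v hv
    have hv' : v ∈ diagSolsEvenOn c n (ev v) := by
      refine ⟨(hev v _).1 rfl, ?_⟩
      simpa [diagSols] using hv
    have := h4 _ (four_dvd_of_mem_diagSolsEvenOn hn hv')
    simp only [Finset.coe_insert, Set.mem_insert_iff, Finset.mem_coe]
    rcases this with h | h
    · left
      rw [Finset.eq_empty_iff_forall_notMem]
      intro i hi
      have := (Finset.sum_eq_zero_iff.1 h) i hi
      exact (hc i).ne' this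
    · right
      simp [𝒯, h]
  have hcard := Finset.card_eq_sum_card_fiberwise hmaps
  rw [← Set.ncard_eq_toFinset_card _ hfin, Finset.sum_insert hempty] at hcard
  simp only [hfib] at hcard
  have hsum : 2 * ∑ T ∈ 𝒯, (diagSolsEvenOn c n T).ncard
      = 𝒯.card * (diagSolsEvenOn c n ∅).ncard := by
    rw [Finset.mul_sum, ← smul_eq_mul, ← Finset.sum_const]
    refine Finset.sum_congr rfl fun T hT => ?_
    have hT4 : ∑ i ∈ T, c i = 4 := by simpa [𝒯] using hT
    rw [ncard_diagSols_odd_eq_two_mul hc hodd hT4, ncard_diagSolsEvenOn_eq hn hT4]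
  have h2 : (2 : ℚ) * (diagSols c n).ncard
      = (2 + 𝒯.card) * (diagSolsEvenOn c n ∅).ncard := by
    rw [hcard]
    have : (2 : ℚ) * ∑ T ∈ 𝒯, ((diagSolsEvenOn c n T).ncard : ℚ)
      = 𝒯.card * (diagSolsEvenOn c n ∅).ncard := by exact_mod_cast hsum
    push_cast
    linear_combination this
  have h3 : (2 + 𝒯.card : ℚ) ≠ 0 := by positivity
  field_simp
  linear_combination -h2

end Reflection

section Theta

open Filter Topology

lemma HasSum.fin_prod_of_nonneg {n : ℕ} {α : Type*} {f : Fin n → α → ℝ} {s : Fin n → ℝ}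
    (hf : ∀ i x, 0 ≤ f i x) (hs : ∀ i, HasSum (f i) (s i)) :
    HasSum (fun v : Fin n → α => ∏ i, f i (v i)) (∏ i, s i) := by
  induction n with
  | zero => simp [hasSum_unique]
  | succ n ih =>
    have h1 := ih (f := fun i => f i.succ) (fun i x => hf _ x) (fun i => hs i.succ)
    have hsum : Summable fun p : α × (Fin n → α) => f 0 p.1 * ∏ i : Fin n, f i.succ (p.2 i) :=
      Summable.mul_of_nonneg (f := f 0) (g := fun v : Fin n → α => ∏ i : Fin n, f i.succ (v i))
        (hs 0).summable h1.summable (hf 0) fun v => Finset.prod_nonneg fun i _ => hf _ _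
    have h2 := HasSum.mul (f := f 0) (g := fun v : Fin n → α => ∏ i : Fin n, f i.succ (v i))
      (hs 0) h1 hsum
    rw [← (Fin.consEquiv fun _ : Fin (n + 1) => α).hasSum_iff, Fin.prod_univ_succ]
    convert! h2 using 2
    simp [Fin.prod_univ_succ]

lemma HasSum.pi_prod_of_nonneg {ι α : Type*} [Fintype ι] {f : ι → α → ℝ} {s : ι → ℝ}
    (hf : ∀ i x, 0 ≤ f i x) (hs : ∀ i, HasSum (f i) (s i)) :
    HasSum (fun v : ι → α => ∏ i, f i (v i)) (∏ i, s i) := by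
  let e := Fintype.equivFin ι
  have := HasSum.fin_prod_of_nonneg (f := fun i => f (e.symm i)) (fun i => hf _) (fun i => hs _)
  rw [e.symm.prod_comp s] at this
  rw [← (e.arrowCongr (Equiv.refl α)).hasSum_iff] at this
  convert! this using 2 with v
  simp [← e.symm.prod_comp (fun i => f i (v i))]

/-- `f` tends to `l` at infinity with error smaller than `s ^ (-r)`. -/
def TendstoRapidly (r : ℝ) (f : ℝ → ℝ) (l : ℝ) : Prop :=
  Tendsto f atTop (𝓝 l) ∧ Tendsto (fun s => s ^ r * (f s - l)) atTop (𝓝 0)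

namespace TendstoRapidly

variable {r : ℝ} {f g : ℝ → ℝ} {l m : ℝ}

lemma const (r l : ℝ) : TendstoRapidly r (fun _ => l) l := by
  constructor <;> simp

lemma mul (hf : TendstoRapidly r f l) (hg : TendstoRapidly r g m) :
    TendstoRapidly r (fun s => f s * g s) (l * m) := by
  refine ⟨hf.1.mul hg.1, ?_⟩
  have := (hf.2.mul hg.1).add (hg.2.const_mul l)
  simp only [zero_mul, mul_zero, add_zero] at this
  exact this.congr fun s => by ring

lemma add (hf : TendstoRapidly r f l) (hg : TendstoRapidly r g m) :
    TendstoRapidly r (fun s => f s + g s) (l + m) := by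
  refine ⟨hf.1.add hg.1, ?_⟩
  have := hf.2.add hg.2
  simp only [add_zero] at this
  exact this.congr fun s => by ring

lemma prod {ι : Type*} (t : Finset ι) {F : ι → ℝ → ℝ} {L : ι → ℝ}
    (h : ∀ i ∈ t, TendstoRapidly r (F i) (L i)) :
    TendstoRapidly r (fun s => ∏ i ∈ t, F i s) (∏ i ∈ t, L i) := by
  classical
  induction t using Finset.induction_on with
  | empty => simpa using const r 1
  | insert a t ha ih =>
    simp only [Finset.prod_insert ha]
    exact (h a (by simp)).mul (ih fun i hi => h i (by simp [hi]))

lemma sum {ι : Type*} (t : Finset ι) {F : ι → ℝ → ℝ} {L : ι → ℝ}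
    (h : ∀ i ∈ t, TendstoRapidly r (F i) (L i)) :
    TendstoRapidly r (fun s => ∑ i ∈ t, F i s) (∑ i ∈ t, L i) := by
  classical
  induction t using Finset.induction_on with
  | empty => simpa using const r 0
  | insert a t ha ih =>
    simp only [Finset.sum_insert ha]
    exact (h a (by simp)).add (ih fun i hi => h i (by simp [hi]))

/-- The kernel dual to a shifted theta series is exponentially close to `1`. -/
lemma cosKernel (r : ℝ) (x : UnitAddCircle) {κ : ℝ} (hκ : 0 < κ) :
    TendstoRapidly r (fun s => HurwitzZeta.cosKernel x (s / κ)) 1 := by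
  obtain ⟨p, hp, hO⟩ := HurwitzZeta.isBigO_atTop_cosKernel_sub x
  have hdiv : Tendsto (fun s : ℝ => s / κ) atTop atTop := tendsto_id.atTop_div_const hκ
  have hO' := hO.comp_tendsto hdiv
  have key : ∀ q : ℝ, Tendsto (fun s : ℝ => s ^ q * (HurwitzZeta.cosKernel x (s / κ) - 1))
      atTop (𝓝 0) := by
    intro q
    have h1 := tendsto_rpow_mul_exp_neg_mul_atTop_nhds_zero q (p / κ) (by positivity)
    refine ((Asymptotics.isBigO_refl (fun s : ℝ => s ^ q) atTop).mul hO').trans_tendsto ?_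
    refine h1.congr fun s => ?_
    simp only [Function.comp]
    congr 2; ring
  refine ⟨?_, key r⟩
  simpa using (key 0).add_const 1

end TendstoRapidly

/-- If `s ^ r * f s` converges and `f` is rapidly convergent, then the limit is `0`. -/
lemma TendstoRapidly.eq_zero_of_tendsto {r : ℝ} (hr : 0 < r) {f : ℝ → ℝ} {l L : ℝ}
    (hf : TendstoRapidly r f l) (hL : Tendsto (fun s => s ^ r * f s) atTop (𝓝 L)) : L = 0 := by
  have hl : l = 0 := by
    refine tendsto_nhds_unique hf.1 ?_
    have := (tendsto_rpow_neg_atTop hr).mul hL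
    rw [zero_mul] at this
    refine this.congr' ?_
    filter_upwards [eventually_gt_atTop 0] with s hs
    rw [← mul_assoc, ← Real.rpow_add hs]; simp
  subst hl
  refine tendsto_nhds_unique hL (hf.2.congr fun s => by simp)

/-- The theta series of a residue class. -/
lemma hasSum_exp_residue (N : ℕ) [NeZero N] (ρ : ZMod N) {t : ℝ} (ht : 0 < t) :
    HasSum (fun x : ℤ => if (x : ZMod N) = ρ then Real.exp (-Real.pi * t * x ^ 2) else 0)
      (1 / (N * t ^ (1 / 2 : ℝ)) *
        HurwitzZeta.cosKernel ((ρ.val / N : ℝ) : UnitAddCircle) (t⁻¹ / N ^ 2)) := by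
  have hN : (0 : ℝ) < N := by exact_mod_cast NeZero.pos N
  have hg : Function.Injective fun k : ℤ => (N : ℤ) * k + ρ.val := by
    intro k l h
    simpa [NeZero.ne N] using h
  rw [← hg.hasSum_iff]
  · have h := HurwitzZeta.hasSum_int_evenKernel (ρ.val / N : ℝ) (t := t * N ^ 2) (by positivity)
    rw [HurwitzZeta.evenKernel_functional_equation] at h
    convert! h using 2 with k
    · simp only [Function.comp]
      rw [if_pos (by simp)]
      congr 1
      push_cast
      field_simp
    · rw [Real.mul_rpow ht.le (by positivity), ← Real.sqrt_eq_rpow (_ ^ 2), Real.sqrt_sq hN.le]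
      ring
    · field_simp
  · intro x hx
    rw [if_neg]
    rintro rfl
    apply hx
    have : ((x : ZMod N).val : ℤ) = x % N := ZMod.val_intCast x
    exact ⟨x / N, by simp only [this]; exact Int.mul_ediv_add_emod x N⟩

lemma hasSum_weighted_theta {ι : Type*} [Fintype ι] [DecidableEq ι] (N : ℕ) [NeZero N] (c : ι → ℕ)
    (hc : ∀ i, 0 < c i) (w : (ι → ZMod N) → ℝ) {s : ℝ} (hs : 0 < s) :
    HasSum (fun v : ι → ℤ => w (fun i => v i) *
        Real.exp (-Real.pi * s⁻¹ * (∑ i, (c i : ℤ) * v i ^ 2 : ℤ)))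
      (s ^ ((Fintype.card ι : ℝ) / 2) * ∑ ρ : ι → ZMod N, w ρ *
        ∏ i, (1 / (N * (c i : ℝ) ^ (1 / 2 : ℝ)) *
        HurwitzZeta.cosKernel (((ρ i).val / N : ℝ) : UnitAddCircle) (s / (c i * N ^ 2)))) := by
  have h1 : ∀ ρ : ι → ZMod N, HasSum (fun v : ι → ℤ => w ρ * ∏ i, if (v i : ZMod N) = ρ i then
      Real.exp (-Real.pi * (c i / s) * v i ^ 2) else 0) _ := fun ρ =>
    (HasSum.pi_prod_of_nonneg (fun i x => by positivity) fun i =>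
      hasSum_exp_residue N (ρ i) (t := c i / s) (div_pos (by exact_mod_cast hc i) hs)).mul_left (w ρ)
  have h2 := hasSum_sum (s := Finset.univ) fun ρ _ => h1 ρ
  convert! h2 using 1
  · funext v
    rw [Finset.sum_eq_single (fun i => (v i : ZMod N))]
    · simp only [if_true]
      rw [← Real.exp_sum]
      congr 2
      push_cast
      rw [Finset.mul_sum]
      refine Finset.sum_congr rfl fun i _ => ?_
      ring
    · intro ρ _ hρ
      obtain ⟨i, hi⟩ := Function.ne_iff.1 hρ
      rw [Finset.prod_eq_zero (Finset.mem_univ i) (if_neg (Ne.symm hi)), mul_zero]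
    · simp
  · rw [Finset.mul_sum]
    refine Finset.sum_congr rfl fun ρ _ => ?_
    have h3 : s ^ ((Fintype.card ι : ℝ) / 2) = ∏ _i : ι, s ^ (1 / 2 : ℝ) := by
      rw [Finset.prod_const, ← Real.rpow_natCast, ← Real.rpow_mul hs.le, Finset.card_univ]
      congr 1; ring
    rw [h3, mul_left_comm, ← Finset.prod_mul_distrib]
    congr 1
    refine Finset.prod_congr rfl fun i _ => ?_
    have hci : (0 : ℝ) < c i := by exact_mod_cast hc i
    rw [Real.div_rpow hci.le hs.le, inv_div, div_div]
    have := Real.rpow_pos_of_pos hs (1 / 2)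
    have := Real.rpow_pos_of_pos hci (1 / 2)
    have hN : (N : ℝ) ≠ 0 := by exact_mod_cast NeZero.ne N
    field_simp

/-- A theta series whose coefficients depend only on residues cannot converge to
a nonzero limit as the nome tends to `1`. -/
lemma weighted_theta_limit_eq_zero {ι : Type*} [Fintype ι] [DecidableEq ι] [Nonempty ι] (N : ℕ)
    [NeZero N] (c : ι → ℕ) (hc : ∀ i, 0 < c i) (w : (ι → ZMod N) → ℝ) {F : ℝ → ℝ} {L : ℝ}
    (hF : ∀ s : ℝ, 0 < s → HasSum (fun v : ι → ℤ => w (fun i => v i) *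
        Real.exp (-Real.pi * s⁻¹ * (∑ i, (c i : ℤ) * v i ^ 2 : ℤ))) (F s))
    (hL : Tendsto F atTop (𝓝 L)) : L = 0 := by
  have hN : (0 : ℝ) < N := by exact_mod_cast NeZero.pos N
  have hr : 0 < (Fintype.card ι : ℝ) / 2 := by
    have := Fintype.card_pos (α := ι)
    positivity
  refine TendstoRapidly.eq_zero_of_tendsto hr
    (TendstoRapidly.sum Finset.univ fun ρ _ => (TendstoRapidly.const _ (w ρ)).mul
      (TendstoRapidly.prod Finset.univ fun i _ => (TendstoRapidly.const _
        (1 / (N * (c i : ℝ) ^ (1 / 2 : ℝ)))).mul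
        (TendstoRapidly.cosKernel _ (((ρ i).val / N : ℝ) : UnitAddCircle)
          (κ := c i * N ^ 2) (mul_pos (by exact_mod_cast hc i) (by positivity))))) (hL.congr' ?_)
  filter_upwards [eventually_gt_atTop 0] with s hs
  exact (hF s hs).unique (hasSum_weighted_theta N c hc w hs)

/-- Proportionality of odd and all representations along the full progression forces
the smaller members of the residue class of `∑ i, c i` not to be represented. -/
lemma diagSols_eq_empty_of_proportional {ι : Type*} [Fintype ι] [Nonempty ι] {c : ι → ℕ}
    (hc : ∀ i, 0 < c i) {C : ℚ}
    (hC : ∀ n : ℕ, ((diagSolsEvenOn c (8 * n + ∑ i, (c i : ℤ)) ∅).ncard : ℚ)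
      = C * (diagSols c (8 * n + ∑ i, (c i : ℤ))).ncard)
    {m : ℕ} (hm : m < ∑ i, c i) (hm8 : m ≡ ∑ i, c i [MOD 8]) : diagSols c m = ∅ := by
  classical
  set M := ∑ i, c i with hM
  have hMZ : ∑ i, (c i : ℤ) = M := by push_cast [hM]; rfl
  rw [hMZ] at hC
  have hCpos : 0 < C := by
    have h0 := hC 0
    have hone : (fun _ => 1 : ι → ℤ) ∈ diagSolsEvenOn c M ∅ := ⟨by simp, by simp [hMZ]⟩
    have hodd : 0 < (diagSolsEvenOn c M ∅).ncard :=
      (Set.ncard_pos ((finite_diagSols hc M).subset fun v hv => hv.2)).2 ⟨_, hone⟩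
    simp only [Nat.cast_zero, mul_zero, zero_add] at h0
    have hodd' : (0 : ℚ) < (diagSolsEvenOn c M ∅).ncard := by exact_mod_cast hodd
    rw [h0] at hodd'
    exact pos_of_mul_pos_left hodd' (by positivity)
  let w : (ι → ZMod 8) → ℝ := fun ρ =>
    (if ∑ i, (c i : ZMod 8) * ρ i ^ 2 = (M : ZMod 8) then (C : ℝ) else 0)
      - if ∀ i, 4 * ρ i = 4 then 1 else 0
  let g : ℕ → ℝ := fun k => (if k ≡ M [MOD 8] then (C : ℝ) * (diagSols c k).ncard else 0)
    - (diagSolsEvenOn c k ∅).ncard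
  have hodd4 : ∀ x : ℤ, 4 * (x : ZMod 8) = 4 ↔ ¬ Even x := by
    intro x
    have : 4 * (x : ZMod 8) = 4 ↔ 4 * x ≡ 4 [ZMOD 8] := by
      simpa using ZMod.intCast_eq_intCast_iff (4 * x) 4 8
    rw [this, Int.even_iff, Int.ModEq]; omega
  have hw : ∀ (k : ℕ) (v : ι → ℤ), v ∈ diagSols c k → w (fun i => v i)
      = (if k ≡ M [MOD 8] then (C : ℝ) else 0) - if v ∈ diagSolsEvenOn c k ∅ then 1 else 0 := by
    intro k v hv
    have h1 : ∑ i, (c i : ZMod 8) * (v i : ZMod 8) ^ 2 = (k : ZMod 8) := by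
      have := congrArg (Int.cast : ℤ → ZMod 8) (show _ = (k : ℤ) from hv)
      push_cast at this
      exact this
    have h2 : v ∈ diagSolsEvenOn c k ∅ ↔ ∀ i, ¬ Even (v i) := by
      refine ⟨fun h i => by simpa using h.1 i, fun h => ⟨fun i => by simpa using h i, hv⟩⟩
    simp only [w, h1, hodd4, h2, ZMod.natCast_eq_natCast_iff]
  let q : (ι → ℤ) → ℕ := fun v => (∑ i, (c i : ℤ) * v i ^ 2).toNat
  have hq : ∀ v, ((q v : ℕ) : ℤ) = ∑ i, (c i : ℤ) * v i ^ 2 := fun v =>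
    Int.toNat_of_nonneg (Finset.sum_nonneg fun i _ => by positivity)
  have hfiber : ∀ s : ℝ, ∀ k : ℕ, ∑' v : q ⁻¹' {k}, w (fun i => (v : ι → ℤ) i) *
        Real.exp (-Real.pi * s⁻¹ * (∑ i, (c i : ℤ) * (v : ι → ℤ) i ^ 2 : ℤ))
      = g k * Real.exp (-Real.pi * s⁻¹ * k) := by
    intro s k
    have hfin := finite_diagSols hc (k : ℤ)
    have hset : q ⁻¹' {k} = (hfin.toFinset : Set (ι → ℤ)) := by
      ext v
      simp only [Set.mem_preimage, Set.mem_singleton_iff, Set.Finite.coe_toFinset]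
      rw [← Nat.cast_inj (R := ℤ), hq]
      rfl
    rw [hset, Finset.tsum_subtype' hfin.toFinset fun v : ι → ℤ => w (fun i => v i) *
        Real.exp (-Real.pi * s⁻¹ * (∑ i, (c i : ℤ) * v i ^ 2 : ℤ))]
    have h1 : ∀ v ∈ hfin.toFinset, w (fun i => v i) *
        Real.exp (-Real.pi * s⁻¹ * (∑ i, (c i : ℤ) * v i ^ 2 : ℤ))
        = ((if k ≡ M [MOD 8] then (C : ℝ) else 0) -
          if v ∈ diagSolsEvenOn c k ∅ then 1 else 0) * Real.exp (-Real.pi * s⁻¹ * k) := by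
      intro v hv
      have hv' : v ∈ diagSols c k := by simpa using hv
      rw [hw k v hv', show ∑ i, (c i : ℤ) * v i ^ 2 = k from hv', Int.cast_natCast]
    rw [Finset.sum_congr rfl h1, ← Finset.sum_mul, Finset.sum_sub_distrib, Finset.sum_const,
      ← Finset.sum_filter, Finset.sum_const, nsmul_eq_mul, nsmul_eq_mul, mul_one,
      ← Set.ncard_eq_toFinset_card _ hfin, ← Set.ncard_coe_finset]
    have h2 : ((hfin.toFinset.filter fun v => v ∈ diagSolsEvenOn c k ∅ : Finset (ι → ℤ)) :
        Set (ι → ℤ)) = diagSolsEvenOn c k ∅ := by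
      ext v
      simp only [Finset.coe_filter, Set.Finite.mem_toFinset, Set.mem_ofPred_eq]
      exact ⟨fun h => h.2, fun h => ⟨h.2, h⟩⟩
    rw [h2]
    simp only [g]
    split_ifs <;> ring
  have hgM : ∀ k, M ≤ k → g k = 0 := by
    intro k hk
    simp only [g]
    split_ifs with hk8
    · obtain ⟨n, hn⟩ := (Nat.modEq_iff_dvd' hk).1 hk8.symm
      have hkn : (k : ℤ) = 8 * n + M := by omega
      rw [hkn, sub_eq_zero]
      exact_mod_cast (hC n).symm
    · have hempty : diagSolsEvenOn c k ∅ = ∅ := by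
        rw [Set.eq_empty_iff_forall_notMem]
        rintro v ⟨hv1, hv2⟩
        have := modEq_eight_sum_sq_of_odd (c := c) (T := Finset.univ) (v := v)
          fun i _ => by simpa using hv1 i
        rw [hv2, hMZ] at this
        exact hk8 ((Int.natCast_modEq_iff (n := 8)).1 this)
      simp [hempty]
  have hlow : ∀ k, k < M → g k = if k ≡ M [MOD 8] then (C : ℝ) * (diagSols c k).ncard else 0 := by
    intro k hk
    have hempty : diagSolsEvenOn c k ∅ = ∅ := by
      rw [Set.eq_empty_iff_forall_notMem]
      rintro v ⟨hv1, hv2⟩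
      have : ∑ i, (c i : ℤ) ≤ ∑ i, (c i : ℤ) * v i ^ 2 := by
        refine Finset.sum_le_sum fun i _ => ?_
        have h0 : v i ≠ 0 := by
          intro h
          simpa [h] using hv1 i
        have h1 : 0 < v i ^ 2 := by positivity
        have h2 : (0 : ℤ) ≤ c i := by positivity
        nlinarith
      rw [hv2, hMZ] at this
      omega
    simp [g, hempty]
  have hF : ∀ s : ℝ, 0 < s → HasSum (fun v : ι → ℤ => w (fun i => v i) *
        Real.exp (-Real.pi * s⁻¹ * (∑ i, (c i : ℤ) * v i ^ 2 : ℤ)))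
      (∑ k ∈ Finset.range M, g k * Real.exp (-Real.pi * s⁻¹ * k)) := by
    intro s hs
    have h1 := hasSum_weighted_theta 8 c hc w hs
    have h2 := h1.tsum_fiberwise q
    simp only [hfiber s] at h2
    have h3 : HasSum (fun k => g k * Real.exp (-Real.pi * s⁻¹ * k)) _ :=
      hasSum_sum_of_ne_finset_zero (s := Finset.range M) fun k hk => by
        rw [hgM k (by simpa using hk), zero_mul]
    rw [← h2.unique h3]
    exact h1
  have hL : Tendsto (fun s : ℝ => ∑ k ∈ Finset.range M, g k * Real.exp (-Real.pi * s⁻¹ * k)) atTop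
      (𝓝 (∑ k ∈ Finset.range M, g k)) := by
    refine tendsto_finsetSum _ fun k _ => ?_
    have h1 : Tendsto (fun s : ℝ => -Real.pi * s⁻¹ * k) atTop (𝓝 0) := by
      simpa using (tendsto_inv_atTop_zero.const_mul (-Real.pi)).mul_const (k : ℝ)
    simpa using ((Real.continuous_exp.tendsto 0).comp h1).const_mul (g k)
  have hzero := weighted_theta_limit_eq_zero 8 c hc w hF hL
  have hnonneg : ∀ k ∈ Finset.range M, 0 ≤ g k := by
    intro k hk
    have : (0 : ℝ) < C := by exact_mod_cast hCpos
    rw [hlow k (by simpa using hk)]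
    positivity
  have hgm := (Finset.sum_eq_zero_iff_of_nonneg hnonneg).1 hzero m (by simpa using hm)
  rw [hlow m hm, if_pos hm8, mul_eq_zero, Rat.cast_eq_zero] at hgm
  have : (diagSols c m).ncard = 0 := by exact_mod_cast hgm.resolve_left hCpos.ne'
  exact (Set.ncard_eq_zero (finite_diagSols hc m)).1 this

end Theta

/-- The weights of the form `x₁² + ⋯ + x_a² + 3y₁² + ⋯ + 3y_b²`. -/
def oneThreeWeights (a b : ℕ) : Fin a ⊕ Fin b → ℕ :=
  Sum.elim (fun _ => 1) (fun _ => 3)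

lemma oneThreeWeights_pos {a b : ℕ} (i : Fin a ⊕ Fin b) : 0 < oneThreeWeights a b i := by
  rcases i with i | i <;> simp [oneThreeWeights]

lemma odd_oneThreeWeights {a b : ℕ} (i : Fin a ⊕ Fin b) : Odd (oneThreeWeights a b i) := by
  rcases i with i | i <;> simp [oneThreeWeights, Nat.odd_iff]

lemma sum_oneThreeWeights (a b : ℕ) : ∑ i, oneThreeWeights a b i = a + 3 * b := by
  simp [oneThreeWeights, mul_comm]

lemma sum_oneThreeWeights_mul_sq {a b : ℕ} (v : Fin a ⊕ Fin b → ℤ) :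
    ∑ i, (oneThreeWeights a b i : ℤ) * v i ^ 2
      = ∑ i, v (Sum.inl i) ^ 2 + 3 * ∑ j, v (Sum.inr j) ^ 2 := by
  simp [oneThreeWeights, Finset.mul_sum]

lemma N_eq_ncard_diagSols (a b : ℕ) (n : ℤ) :
    N a b n = (diagSols (oneThreeWeights a b) n).ncard := by
  refine Set.ncard_congr (fun p _ => Sum.elim p.1 p.2) ?_ ?_ ?_
  · intro p hp
    exact (sum_oneThreeWeights_mul_sq _).trans (Eq.symm hp)
  · intro p p' _ _ h
    exact Prod.ext (funext fun i => congrFun h (Sum.inl i)) (funext fun i => congrFun h (Sum.inr i))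
  · intro v hv
    exact ⟨(fun i => v (Sum.inl i), fun j => v (Sum.inr j)),
      Eq.symm (Eq.trans (sum_oneThreeWeights_mul_sq v).symm hv), Sum.elim_comp_inl_inr v⟩

lemma Nstar_eq_ncard_diagSolsEvenOn (a b : ℕ) (n : ℤ) :
    Nstar a b n = (diagSolsEvenOn (oneThreeWeights a b) n ∅).ncard := by
  refine Set.ncard_congr (fun p _ => Sum.elim p.1 p.2) ?_ ?_ ?_
  · intro p hp
    refine ⟨?_, (sum_oneThreeWeights_mul_sq _).trans hp.2.2.symm⟩
    rintro (i | i)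
    · simpa using hp.1 i
    · simpa using hp.2.1 i
  · intro p p' _ _ h
    exact Prod.ext (funext fun i => congrFun h (Sum.inl i)) (funext fun i => congrFun h (Sum.inr i))
  · intro v hv
    refine ⟨(fun i => v (Sum.inl i), fun j => v (Sum.inr j)), ⟨fun i => ?_, fun j => ?_, ?_⟩,
      Sum.elim_comp_inl_inr v⟩
    · simpa using hv.1 (Sum.inl i)
    · simpa using hv.1 (Sum.inr j)
    · exact Eq.symm (Eq.trans (sum_oneThreeWeights_mul_sq v).symm hv.2)

lemma sum_sq_ite_lt {a k : ℕ} (hk : k ≤ a) :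
    ∑ i : Fin a, (if (i : ℕ) < k then (0 : ℤ) else 1) ^ 2 = a - k := by
  rw [Fin.sum_univ_eq_sum_range (fun i => (if i < k then (0 : ℤ) else 1) ^ 2) a,
    ← Finset.sum_range_add_sum_Ico _ hk,
    Finset.sum_congr rfl fun i hi => by rw [if_pos (Finset.mem_range.1 hi)],
    Finset.sum_congr (s₁ := Finset.Ico k a) rfl fun i hi => by
      rw [if_neg (Finset.mem_Ico.1 hi).1.not_gt]]
  simp [hk]

/-- Proportionality fails once a sub-collection of coordinates has positive total weight
divisible by `8`. -/
lemma not_exists_proportional {a b k l : ℕ} (hk : k ≤ a) (hl : l ≤ b) (hpos : 0 < k + 3 * l)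
    (h8 : 8 ∣ k + 3 * l) :
    ¬ ∃ C : ℚ, ∀ n : ℕ, (Nstar a b (8 * (n : ℤ) + a + 3 * b) : ℚ)
      = C * (N a b (8 * (n : ℤ) + a + 3 * b) : ℚ) := by
  rintro ⟨C, hC⟩
  have hsum : ∑ i, (oneThreeWeights a b i : ℤ) = a + 3 * b := by
    exact_mod_cast sum_oneThreeWeights a b
  have : Nonempty (Fin a ⊕ Fin b) := by
    rw [← Fintype.card_pos_iff]
    simp only [Fintype.card_sum, Fintype.card_fin]
    omega
  have hempty := diagSols_eq_empty_of_proportional (c := oneThreeWeights a b) (C := C)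
    (m := a + 3 * b - (k + 3 * l)) oneThreeWeights_pos (fun n => by
      rw [hsum, ← add_assoc, ← N_eq_ncard_diagSols, ← Nstar_eq_ncard_diagSolsEvenOn, hC n])
    (by rw [sum_oneThreeWeights]; omega)
    (by rw [sum_oneThreeWeights, Nat.modEq_iff_dvd' (by omega)]; omega)
  refine Set.eq_empty_iff_forall_notMem.1 hempty (Sum.elim (fun i => if (i : ℕ) < k then 0 else 1)
    (fun j => if (j : ℕ) < l then 0 else 1)) ?_
  refine (sum_oneThreeWeights_mul_sq _).trans ?_
  simp only [Sum.elim_inl, Sum.elim_inr, sum_sq_ite_lt hk, sum_sq_ite_lt hl]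
  omega

lemma exists_proportional {a b : ℕ}
    (h4 : ∀ T : Finset (Fin a ⊕ Fin b), 4 ∣ ∑ i ∈ T, oneThreeWeights a b i →
      ∑ i ∈ T, oneThreeWeights a b i = 0 ∨ ∑ i ∈ T, oneThreeWeights a b i = 4) :
    ∃ C : ℚ, ∀ n : ℕ, (Nstar a b (8 * (n : ℤ) + a + 3 * b) : ℚ)
      = C * (N a b (8 * (n : ℤ) + a + 3 * b) : ℚ) := by
  obtain ⟨C, hC⟩ := exists_ncard_odd_eq_mul oneThreeWeights_pos odd_oneThreeWeights h4
  refine ⟨C, fun n => ?_⟩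
  rw [N_eq_ncard_diagSols, Nstar_eq_ncard_diagSolsEvenOn]
  refine hC _ ?_
  rw [show ∑ i, (oneThreeWeights a b i : ℤ) = a + 3 * b by exact_mod_cast sum_oneThreeWeights a b,
    Int.modEq_iff_dvd]
  exact ⟨-n, by ring⟩

lemma sum_finset_oneThreeWeights {a b : ℕ} (T : Finset (Fin a ⊕ Fin b)) :
    ∑ i ∈ T, oneThreeWeights a b i = T.toLeft.card + 3 * T.toRight.card := by
  conv_lhs => rw [← T.toLeft_disjSum_toRight, Finset.sum_disjSum]
  simp [oneThreeWeights, mul_comm]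

lemma exists_proportional_one_three :
    ∃ C : ℚ, ∀ n : ℕ, (Nstar 1 3 (8 * (n : ℤ) + (1 : ℕ) + 3 * (3 : ℕ)) : ℚ)
      = C * (N 1 3 (8 * (n : ℤ) + (1 : ℕ) + 3 * (3 : ℕ)) : ℚ) := by
  refine exists_proportional fun T hT => ?_
  have h1 := card_finset_fin_le T.toLeft
  have h2 := card_finset_fin_le T.toRight
  rw [sum_finset_oneThreeWeights] at hT ⊢
  interval_cases T.toRight.card <;> omega

lemma exists_proportional_of_lt {a b : ℕ} (hab : a + 3 * b < 8) :
    ∃ C : ℚ, ∀ n : ℕ, (Nstar a b (8 * (n : ℤ) + a + 3 * b) : ℚ)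
      = C * (N a b (8 * (n : ℤ) + a + 3 * b) : ℚ) := by
  refine exists_proportional fun T hT => ?_
  have := Finset.sum_le_univ_sum_of_nonneg (s := T) (f := oneThreeWeights a b) fun _ => zero_le
  rw [sum_oneThreeWeights] at this
  omega

lemma N_zero_left_three_mul (b : ℕ) (n : ℤ) : N 0 b (3 * n) = N b 0 n := by
  refine Set.ncard_congr (fun p _ => (p.2, p.1)) ?_ ?_ ?_
  · rintro ⟨x, y⟩ h
    simpa using h
  · rintro ⟨x, y⟩ ⟨x', y'⟩ _ _ h
    simpa [and_comm] using h
  · rintro ⟨x, y⟩ h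
    exact ⟨(y, x), by simpa using h, rfl⟩

lemma Nstar_zero_left_three_mul (b : ℕ) (n : ℤ) : Nstar 0 b (3 * n) = Nstar b 0 n := by
  refine Set.ncard_congr (fun p _ => (p.2, p.1)) ?_ ?_ ?_
  · rintro ⟨x, y⟩ h
    simpa using h
  · rintro ⟨x, y⟩ ⟨x', y'⟩ _ _ h
    simpa [and_comm] using h
  · rintro ⟨x, y⟩ h
    exact ⟨(y, x), by simpa using h, rfl⟩

lemma Nstar_zero_left_eq_zero {b : ℕ} {n : ℤ} (hn : ¬ 3 ∣ n) : Nstar 0 b n = 0 := by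
  have : {p : (Fin 0 → ℤ) × (Fin b → ℤ) | (∀ i, Odd (p.1 i)) ∧ (∀ j, Odd (p.2 j)) ∧
      n = ∑ i, (p.1 i) ^ 2 + 3 * ∑ j, (p.2 j) ^ 2} = ∅ := by
    rw [Set.eq_empty_iff_forall_notMem]
    rintro p ⟨-, -, h⟩
    exact hn ⟨_, by simpa using h⟩
  rw [Nstar, this, Set.ncard_empty]

lemma N_zero_left_eq_zero {b : ℕ} {n : ℤ} (hn : ¬ 3 ∣ n) : N 0 b n = 0 := by
  have : {p : (Fin 0 → ℤ) × (Fin b → ℤ) | n = ∑ i, (p.1 i) ^ 2 + 3 * ∑ j, (p.2 j) ^ 2} = ∅ := by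
    rw [Set.eq_empty_iff_forall_notMem]
    intro p h
    exact hn ⟨_, by simpa using h⟩
  rw [N, this, Set.ncard_empty]

lemma exists_proportional_zero_left {b : ℕ} (hb : b < 8) :
    ∃ C : ℚ, ∀ n : ℕ, (Nstar 0 b (8 * (n : ℤ) + (0 : ℕ) + 3 * b) : ℚ)
      = C * (N 0 b (8 * (n : ℤ) + (0 : ℕ) + 3 * b) : ℚ) := by
  obtain ⟨C, hC⟩ := exists_proportional_of_lt (a := b) (b := 0) (by omega)
  refine ⟨C, fun n => ?_⟩
  by_cases h3 : 3 ∣ n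
  · obtain ⟨k, rfl⟩ := h3
    have h := hC k
    rw [show 8 * ((3 * k : ℕ) : ℤ) + (0 : ℕ) + 3 * b = 3 * (8 * k + b + 3 * (0 : ℕ)) by
      push_cast; ring, N_zero_left_three_mul, Nstar_zero_left_three_mul, h]
  · have h3' : ¬ (3 : ℤ) ∣ 8 * (n : ℤ) + (0 : ℕ) + 3 * b := by omega
    rw [N_zero_left_eq_zero h3', Nstar_zero_left_eq_zero h3']
    simp

theorem stmt_0 (a b : ℕ) (hab : (a, b) ≠ (0, 0)) (hpar : Even (a + b)) :
    (∃ C : ℚ, ∀ n : ℕ,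
        (Nstar a b (8 * (n : ℤ) + a + 3 * b) : ℚ)
          = C * (N a b (8 * (n : ℤ) + a + 3 * b) : ℚ)) ↔
      (a, b) ∈ ({(0, 2), (0, 4), (0, 6), (1, 1), (1, 3), (2, 0), (3, 1), (4, 0), (6, 0)} :
        Set (ℕ × ℕ)) := by
  simp only [Set.mem_insert_iff, Set.mem_singleton_iff, Prod.mk.injEq]
  rw [Nat.even_iff] at hpar
  constructor
  · intro h
    have h80 : a < 8 := by
      by_contra! ha
      exact not_exists_proportional (k := 8) (l := 0) ha (by omega) (by omega) (by omega) h
    have h08 : b < 8 := by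
      by_contra! hb
      exact not_exists_proportional (k := 0) (l := 8) (by omega) hb (by omega) (by omega) h
    have h51 : ¬ (5 ≤ a ∧ 1 ≤ b) := fun ⟨ha, hb⟩ =>
      not_exists_proportional ha hb (by omega) (by omega) h
    have h22 : ¬ (2 ≤ a ∧ 2 ≤ b) := fun ⟨ha, hb⟩ =>
      not_exists_proportional ha hb (by omega) (by omega) h
    have h15 : ¬ (1 ≤ a ∧ 5 ≤ b) := fun ⟨ha, hb⟩ =>
      not_exists_proportional ha hb (by omega) (by omega) h
    have h00 : ¬ (a = 0 ∧ b = 0) := fun ⟨ha, hb⟩ => hab (by rw [ha, hb])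
    clear h hab
    interval_cases a <;> interval_cases b <;> simp at hpar h51 h22 h15 h00 ⊢
  · rintro (⟨rfl, rfl⟩ | ⟨rfl, rfl⟩ | ⟨rfl, rfl⟩ | ⟨rfl, rfl⟩ | ⟨rfl, rfl⟩ | ⟨rfl, rfl⟩ |
      ⟨rfl, rfl⟩ | ⟨rfl, rfl⟩ | ⟨rfl, rfl⟩)
    · exact exists_proportional_zero_left (by norm_num)
    · exact exists_proportional_zero_left (by norm_num)
    · exact exists_proportional_zero_left (by norm_num)
    · exact exists_proportional_of_lt (by norm_num)
    · exact exists_proportional_one_three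
    · exact exists_proportional_of_lt (by norm_num)
    · exact exists_proportional_of_lt (by norm_num)
    · exact exists_proportional_of_lt (by norm_num)
    · exact exists_proportional_of_lt (by norm_num)
end

section
/- Let a and b be nonnegative integers, not both zero, with a + b even and a + 3b ≡ 0 (mod 4). There exists a rational constant C̃ (depending only on a and b) such that N*(a,b; 8n+a+3b) = C̃ · Ñ(a,b; 8n+a+3b) holds for every nonnegative integer n if and only if (a,b) belongs to the set S̃ = {(0,4), (0,8), (1,1), (1,5), (2,2), (4,0), (5,1), (8,0)}. -/
/-- `Ntilde a b n = N a b n - N a b (n/4)`, where the second term is `0` when `4 ∤ n`. -/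
noncomputable def Ntilde (a b : ℕ) (n : ℤ) : ℤ :=
  (N a b n : ℤ) - (if (4 : ℤ) ∣ n then (N a b (n / 4) : ℤ) else 0)

section

open Finset

/-- The weighted generating series `∑ x, w x * q ^ Q x`. -/
noncomputable def genSeries {X : Type*} (Q : X → ℕ) (w : X → ℝ) : PowerSeries ℝ :=
  PowerSeries.mk fun n => ∑ᶠ x ∈ {x | Q x = n}, w x

/-- All fibres of `Q` are finite. -/
def FiniteFibers {X : Type*} (Q : X → ℕ) : Prop := ∀ n, {x | Q x = n}.Finite

theorem FiniteFibers.add {X Y : Type*} {Q : X → ℕ} {Q' : Y → ℕ} (h : FiniteFibers Q)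
    (h' : FiniteFibers Q') : FiniteFibers (fun p : X × Y => Q p.1 + Q' p.2) := by
  intro n
  refine ((Set.finite_Iic n).biUnion fun k _ => (Set.finite_Iic n).biUnion fun l _ =>
    (h k).prod (h' l)).subset ?_
  intro p hp
  simp only [Set.mem_ofPred_eq] at hp
  simp only [Set.mem_iUnion, Set.mem_Iic, Set.mem_prod, Set.mem_ofPred_eq]
  exact ⟨Q p.1, by omega, Q' p.2, by omega, rfl, rfl⟩

theorem genSeries_mul {X Y : Type*} {Q : X → ℕ} {Q' : Y → ℕ} (h : FiniteFibers Q)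
    (h' : FiniteFibers Q') (w : X → ℝ) (w' : Y → ℝ) :
    genSeries Q w * genSeries Q' w' =
      genSeries (fun p : X × Y => Q p.1 + Q' p.2) (fun p => w p.1 * w' p.2) := by
  classical
  ext n
  simp only [genSeries, PowerSeries.coeff_mul, PowerSeries.coeff_mk]
  rw [finsum_mem_eq_finite_toFinset_sum _ (h.add h' n)]
  rw [← Finset.sum_fiberwise_of_maps_to (t := antidiagonal n)
    (g := fun p : X × Y => (Q p.1, Q' p.2)) (by intro p hp; simpa using hp)]
  refine Finset.sum_congr rfl fun kl hkl => ?_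
  rw [finsum_mem_eq_finite_toFinset_sum _ (h kl.1), finsum_mem_eq_finite_toFinset_sum _ (h' kl.2),
    Finset.sum_mul_sum, ← Finset.sum_product']
  refine Finset.sum_congr ?_ fun _ _ => rfl
  ext p
  have := mem_antidiagonal.1 hkl
  simp only [mem_product, Set.Finite.mem_toFinset, Set.mem_ofPred_eq, mem_filter, Prod.ext_iff]
  grind

theorem genSeries_reindex {X Y : Type*} {Q : X → ℕ} {Q' : Y → ℕ} {w : X → ℝ} {w' : Y → ℝ}
    (e : X → Y) (he : Function.Injective e) (hQ : ∀ x, Q' (e x) = Q x)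
    (hw : ∀ x, w' (e x) = w x) (h0 : ∀ y, w' y ≠ 0 → y ∈ Set.range e) :
    genSeries Q' w' = genSeries Q w := by
  ext n
  simp only [genSeries, PowerSeries.coeff_mk]
  have : ∑ᶠ x ∈ {x | Q x = n}, w x = ∑ᶠ y ∈ e '' {x | Q x = n}, w' y := by
    rw [finsum_mem_image he.injOn]
    simp only [hw]
  rw [this]
  apply finsum_mem_inter_support_eq
  ext y
  simp only [Set.mem_inter_iff, Set.mem_ofPred_eq, Set.mem_image, Function.mem_support]
  constructor
  · rintro ⟨h1, h2⟩
    obtain ⟨x, rfl⟩ := h0 y h2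
    exact ⟨⟨x, by rw [← hQ, h1], rfl⟩, h2⟩
  · rintro ⟨⟨x, h1, rfl⟩, h2⟩
    exact ⟨by rw [hQ, h1], h2⟩

theorem genSeries_add {X : Type*} {Q : X → ℕ} (h : FiniteFibers Q) (w w' : X → ℝ) :
    genSeries Q w + genSeries Q w' = genSeries Q (fun x => w x + w' x) := by
  ext n
  simp only [genSeries, map_add, PowerSeries.coeff_mk]
  rw [finsum_mem_add_distrib (h n)]

theorem genSeries_sub {X : Type*} {Q : X → ℕ} (h : FiniteFibers Q) (w w' : X → ℝ) :
    genSeries Q w - genSeries Q w' = genSeries Q (fun x => w x - w' x) := by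
  ext n
  simp only [genSeries, map_sub, PowerSeries.coeff_mk]
  exact (finsum_mem_sub_distrib w w' (h n)).symm

theorem FiniteFibers.tuple {X : Type*} {Q : X → ℕ} (h : FiniteFibers Q) (a : ℕ) :
    FiniteFibers (fun x : Fin a → X => ∑ i, Q (x i)) := by
  intro n
  refine (Set.Finite.pi' (t := fun _ : Fin a => ⋃ k ∈ Set.Iic n, {x | Q x = k}) fun _ =>
    (Set.finite_Iic n).biUnion fun k _ => h k).subset ?_
  intro x hx i
  simp only [Set.mem_iUnion, Set.mem_Iic, Set.mem_ofPred_eq] at hx ⊢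
  exact ⟨Q (x i), hx ▸ Finset.single_le_sum (f := fun i => Q (x i)) (fun _ _ => Nat.zero_le _)
    (mem_univ i), rfl⟩

theorem genSeries_pow {X : Type*} {Q : X → ℕ} (h : FiniteFibers Q) (w : X → ℝ) (a : ℕ) :
    genSeries Q w ^ a =
      genSeries (fun x : Fin a → X => ∑ i, Q (x i)) (fun x => ∏ i, w (x i)) := by
  induction a with
  | zero =>
    ext n
    simp only [pow_zero, genSeries, PowerSeries.coeff_mk, PowerSeries.coeff_one, univ_eq_empty,
      sum_empty, prod_empty]
    split_ifs with hn
    · subst hn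
      simp [finsum_unique]
    · simp [Ne.symm hn]
  | succ a ih =>
    rw [pow_succ', ih, genSeries_mul h (h.tuple a)]
    symm
    apply genSeries_reindex (fun p : X × (Fin a → X) => Fin.cons p.1 p.2)
    · intro p q hpq
      obtain ⟨h1, h2⟩ := Fin.cons_injective2 hpq
      exact Prod.ext h1 h2
    · intro p
      simp [Fin.sum_univ_succ]
    · intro p
      simp [Fin.prod_univ_succ]
    · intro y _
      exact ⟨(y 0, Fin.tail y), Fin.cons_self_tail y⟩

theorem coeff_genSeries_indicator {X : Type*} (Q : X → ℕ) (p : X → Prop) [DecidablePred p] (n : ℕ) :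
    PowerSeries.coeff n (genSeries Q (fun x => if p x then 1 else 0)) =
      (Set.ncard {x | p x ∧ Q x = n} : ℝ) := by
  simp only [genSeries, PowerSeries.coeff_mk]
  have h1 : ((Set.ncard {x | p x ∧ Q x = n} : ℕ) : ℝ) = ∑ᶠ x ∈ {x | p x ∧ Q x = n}, (1 : ℝ) := by
    by_cases hf : {x | p x ∧ Q x = n}.Finite
    · rw [finsum_mem_eq_finite_toFinset_sum _ hf, Set.ncard_eq_toFinset_card _ hf]; simp
    · rw [Set.Infinite.ncard hf, finsum_mem_eq_zero_of_infinite]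
      · simp
      · simpa [Function.support_const] using hf
  rw [h1]
  have h2 : ∑ᶠ x ∈ {x | p x ∧ Q x = n}, (1 : ℝ) =
      ∑ᶠ x ∈ {x | p x ∧ Q x = n}, (if p x then 1 else 0 : ℝ) :=
    finsum_mem_congr rfl fun x hx => by simp [hx.1]
  rw [h2]
  apply finsum_mem_inter_support_eq
  ext x
  simp only [Set.mem_inter_iff, Set.mem_ofPred_eq, Function.mem_support]
  grind

/-- The exponent `c * x ^ 2`. -/
def scaledSq (c : ℕ) (x : ℤ) : ℕ := c * x.natAbs ^ 2

theorem finiteFibers_scaledSq {c : ℕ} (hc : 0 < c) : FiniteFibers (scaledSq c) := by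
  intro n
  refine (Set.finite_Icc (-(n : ℤ)) n).subset ?_
  intro x hx
  simp only [Set.mem_ofPred_eq, scaledSq] at hx
  have : x.natAbs ≤ n := by nlinarith [sq_nonneg (x.natAbs : ℤ), Nat.le_self_pow two_ne_zero x.natAbs]
  simp only [Set.mem_Icc]
  omega

/-- `∑ q ^ (c x²)` over all integers `x`. -/
noncomputable def thetaSeries (c : ℕ) : PowerSeries ℝ := genSeries (scaledSq c) fun _ => 1

/-- `∑ q ^ (c x²)` over even `x`. -/
noncomputable def evenSeries (c : ℕ) : PowerSeries ℝ :=
  genSeries (scaledSq c) fun x => if Even x then 1 else 0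

/-- `∑ q ^ (c x²)` over odd `x`. -/
noncomputable def oddSeries (c : ℕ) : PowerSeries ℝ :=
  genSeries (scaledSq c) fun x => if Odd x then 1 else 0

/-- `∑ (-1) ^ (x / 2) q ^ (c x²)` over even `x`. -/
noncomputable def twistSeries (c : ℕ) : PowerSeries ℝ :=
  genSeries (scaledSq c) fun x => if 4 ∣ x then 1 else if 2 ∣ x then -1 else 0

theorem even_add_odd {c : ℕ} (hc : 0 < c) : evenSeries c + oddSeries c = thetaSeries c := by
  unfold evenSeries oddSeries thetaSeries
  rw [genSeries_add (finiteFibers_scaledSq hc)]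
  congr 1
  ext x
  rcases Int.even_or_odd x with h | h
  · simp [h]
  · simp [h]

theorem even_eq_theta (c : ℕ) : evenSeries c = thetaSeries (4 * c) := by
  apply genSeries_reindex (fun x : ℤ => 2 * x)
  · intro x y h; simpa using h
  · intro x; simp only [scaledSq, Int.natAbs_mul]; simp; ring
  · intro x; simp
  · intro y hy
    have : Even y := by by_contra h; simp [h] at hy
    obtain ⟨r, hr⟩ := this
    exact ⟨r, by simp only; omega⟩

theorem twist_add_even {c : ℕ} (hc : 0 < c) :
    twistSeries c + evenSeries c = 2 * thetaSeries (16 * c) := by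
  have h : genSeries (scaledSq c) (fun x => if 4 ∣ x then 1 else 0) = thetaSeries (16 * c) := by
    apply genSeries_reindex (fun x : ℤ => 4 * x)
    · intro x y h; simpa using h
    · intro x; simp only [scaledSq, Int.natAbs_mul]; simp; ring
    · intro x; simp
    · intro y hy
      have : 4 ∣ y := by by_contra h; simp [h] at hy
      obtain ⟨r, hr⟩ := this
      exact ⟨r, by simp only; omega⟩
  rw [← h, two_mul]
  unfold evenSeries twistSeries
  rw [genSeries_add (finiteFibers_scaledSq hc), genSeries_add (finiteFibers_scaledSq hc)]
  congr 1
  ext x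
  by_cases h4 : 4 ∣ x
  · have : Even x := by obtain ⟨r, rfl⟩ := h4; exact ⟨2 * r, by ring⟩
    simp [h4, this]
  · by_cases h2 : 2 ∣ x
    · simp [h4, h2, even_iff_two_dvd]
    · simp [h4, h2, even_iff_two_dvd]

theorem genSeries_pow_mul_pow (w w' : ℤ → ℝ) (a b c d : ℕ) (hc : 0 < c) (hd : 0 < d) :
    genSeries (scaledSq c) w ^ a * genSeries (scaledSq d) w' ^ b =
      genSeries (fun p : (Fin a → ℤ) × (Fin b → ℤ) =>
        ∑ i, scaledSq c (p.1 i) + ∑ j, scaledSq d (p.2 j))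
        (fun p => (∏ i, w (p.1 i)) * ∏ j, w' (p.2 j)) := by
  rw [genSeries_pow (finiteFibers_scaledSq hc), genSeries_pow (finiteFibers_scaledSq hd),
    genSeries_mul ((finiteFibers_scaledSq hc).tuple a) ((finiteFibers_scaledSq hd).tuple b)]

theorem coeff_pow_mul_pow (P P' : ℤ → Prop) [DecidablePred P] [DecidablePred P']
    (a b c d n : ℕ) (hc : 0 < c) (hd : 0 < d) :
    PowerSeries.coeff n (genSeries (scaledSq c) (fun x => if P x then 1 else 0) ^ a *
      genSeries (scaledSq d) (fun x => if P' x then 1 else 0) ^ b) =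
    (Set.ncard {p : (Fin a → ℤ) × (Fin b → ℤ) | ((∀ i, P (p.1 i)) ∧ ∀ j, P' (p.2 j)) ∧
      (n : ℤ) = c * ∑ i, (p.1 i) ^ 2 + d * ∑ j, (p.2 j) ^ 2} : ℝ) := by
  classical
  rw [genSeries_pow_mul_pow _ _ _ _ _ _ hc hd]
  have : (fun p : (Fin a → ℤ) × (Fin b → ℤ) =>
      (∏ i, if P (p.1 i) then (1 : ℝ) else 0) * ∏ j, if P' (p.2 j) then (1 : ℝ) else 0) =
      fun p => if (∀ i, P (p.1 i)) ∧ ∀ j, P' (p.2 j) then 1 else 0 := by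
    ext p
    simp only [Finset.prod_ite_zero, Finset.mem_univ, forall_const, Finset.prod_const_one]
    split_ifs <;> simp_all
  rw [this, coeff_genSeries_indicator]
  congr 2
  ext p
  simp only [Set.mem_ofPred_eq, scaledSq]
  refine and_congr_right fun _ => ?_
  rw [← Nat.cast_inj (R := ℤ)]
  push_cast
  simp only [sq_abs, ← Finset.mul_sum]
  exact eq_comm

theorem coeff_theta (a b n : ℕ) :
    PowerSeries.coeff n (thetaSeries 1 ^ a * thetaSeries 3 ^ b) = (N a b n : ℝ) := by
  have := coeff_pow_mul_pow (fun _ => True) (fun _ => True) a b 1 3 n one_pos three_pos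
  simpa [N, thetaSeries] using this

theorem coeff_odd (a b n : ℕ) :
    PowerSeries.coeff n (oddSeries 1 ^ a * oddSeries 3 ^ b) = (Nstar a b n : ℝ) := by
  have := coeff_pow_mul_pow Odd Odd a b 1 3 n one_pos three_pos
  simpa [Nstar, oddSeries, and_assoc] using this

theorem coeff_even (a b n : ℕ) :
    PowerSeries.coeff n (evenSeries 1 ^ a * evenSeries 3 ^ b) =
      if (4 : ℤ) ∣ n then (N a b ((n : ℤ) / 4) : ℝ) else 0 := by
  have := coeff_pow_mul_pow (fun _ => True) (fun _ => True) a b 4 12 n (by norm_num) (by norm_num)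
  rw [even_eq_theta, even_eq_theta]
  simp only [thetaSeries, mul_one]
  norm_num at this ⊢
  rw [this]
  split_ifs with h
  · obtain ⟨k, hk⟩ := h
    rw [hk, Int.mul_ediv_cancel_left _ (by norm_num), N]
    refine congrArg (fun s => ((Set.ncard s : ℕ) : ℝ)) ?_
    ext p
    simp only [Set.mem_ofPred_eq]
    constructor <;> intro h <;> linarith
  · rw [Nat.cast_eq_zero]
    refine (congrArg Set.ncard ?_).trans (Set.ncard_empty ((Fin a → ℤ) × (Fin b → ℤ)))
    ext p
    simp only [Set.mem_ofPred_eq, Set.mem_empty_iff_false, iff_false]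
    intro h'
    apply h
    rw [h']
    exact ⟨∑ i, (p.1 i) ^ 2 + 3 * ∑ j, (p.2 j) ^ 2, by ring⟩

theorem coeff_Ntilde (a b n : ℕ) :
    PowerSeries.coeff n (thetaSeries 1 ^ a * thetaSeries 3 ^ b -
      evenSeries 1 ^ a * evenSeries 3 ^ b) = (Ntilde a b n : ℝ) := by
  rw [map_sub, coeff_theta, coeff_even, Ntilde]
  push_cast
  rfl

theorem Ntilde_nonneg (a b n : ℕ) : 0 ≤ Ntilde a b n := by
  have h := coeff_Ntilde a b n
  unfold thetaSeries evenSeries at h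
  rw [genSeries_pow_mul_pow _ _ _ _ _ _ one_pos three_pos,
    genSeries_pow_mul_pow _ _ _ _ _ _ one_pos three_pos, genSeries_sub
    (((finiteFibers_scaledSq one_pos).tuple a).add ((finiteFibers_scaledSq three_pos).tuple b))] at h
  simp only [genSeries, PowerSeries.coeff_mk] at h
  rw [← Int.cast_nonneg_iff (R := ℝ), ← h]
  refine finsum_nonneg fun p => finsum_nonneg fun _ => ?_
  rw [sub_nonneg]
  simp only [Finset.prod_const_one, mul_one]
  exact mul_le_one₀ (Finset.prod_le_one (fun _ _ => by split_ifs <;> simp)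
    fun _ _ => by split_ifs <;> simp) (Finset.prod_nonneg fun _ _ => by split_ifs <;> simp)
    (Finset.prod_le_one (fun _ _ => by split_ifs <;> simp) fun _ _ => by split_ifs <;> simp)

/-- All exponents of `f` are congruent to `r` modulo `8`. -/
def SupportedMod (r : ZMod 8) (f : PowerSeries ℝ) : Prop :=
  ∀ n : ℕ, PowerSeries.coeff n f ≠ 0 → (n : ZMod 8) = r

theorem SupportedMod.one : SupportedMod 0 1 := by
  intro n hn
  rw [PowerSeries.coeff_one] at hn
  simp_all

theorem SupportedMod.mul {r s : ZMod 8} {f g : PowerSeries ℝ} (hf : SupportedMod r f)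
    (hg : SupportedMod s g) : SupportedMod (r + s) (f * g) := by
  intro n hn
  rw [PowerSeries.coeff_mul] at hn
  obtain ⟨p, hp, h⟩ := Finset.exists_ne_zero_of_sum_ne_zero hn
  rw [← mem_antidiagonal.1 hp, Nat.cast_add, hf _ (left_ne_zero_of_mul h),
    hg _ (right_ne_zero_of_mul h)]

theorem SupportedMod.pow {r : ZMod 8} {f : PowerSeries ℝ} (hf : SupportedMod r f) (k : ℕ) :
    SupportedMod (k * r) (f ^ k) := by
  induction k with
  | zero => simpa using SupportedMod.one
  | succ k ih => rw [pow_succ, Nat.cast_succ, add_mul, one_mul]; exact ih.mul hf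

theorem supportedMod_genSeries {X : Type*} {Q : X → ℕ} {w : X → ℝ} {r : ZMod 8}
    (h : ∀ x, w x ≠ 0 → (Q x : ZMod 8) = r) : SupportedMod r (genSeries Q w) := by
  intro n hn
  simp only [genSeries, PowerSeries.coeff_mk] at hn
  by_contra hne
  refine hn (finsum_mem_eq_zero_of_forall_eq_zero fun x hx => ?_)
  by_contra hw
  exact hne (hx ▸ h x hw)

theorem ZMod.eight_sq_of_odd {x : ℤ} (hx : Odd x) : ((x.natAbs : ZMod 8)) ^ 2 = 1 := by
  obtain ⟨k, hk⟩ := Int.natAbs_odd.2 hx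
  have : ∀ k : ZMod 8, (2 * k + 1) ^ 2 = 1 := by decide
  rw [hk, Nat.cast_add, Nat.cast_mul, Nat.cast_one, Nat.cast_ofNat, this]

theorem supportedMod_oddSeries (c : ℕ) : SupportedMod c (oddSeries c) := by
  refine supportedMod_genSeries fun x hx => ?_
  have hx : Odd x := by by_contra h; simp [h] at hx
  rw [scaledSq, Nat.cast_mul, Nat.cast_pow, ZMod.eight_sq_of_odd hx, mul_one]

/-- The sign with which an even exponent class modulo `8` is twisted. -/
def signMod : ZMod 8 → ℤ := fun r => if r = 0 then 1 else if r = 4 then -1 else 0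

/-- `g` is obtained from `f`, whose exponents are divisible by `4`, by the sign twist. -/
def IsTwist (f g : PowerSeries ℝ) : Prop :=
  ∀ n : ℕ, PowerSeries.coeff n g = signMod n * PowerSeries.coeff n f ∧
    (PowerSeries.coeff n f ≠ 0 → (n : ZMod 8) = 0 ∨ (n : ZMod 8) = 4)

theorem IsTwist.one : IsTwist 1 1 := by
  intro n
  rw [PowerSeries.coeff_one]
  split_ifs with h
  · simp [h, signMod]
  · simp

theorem IsTwist.mul {f g f' g' : PowerSeries ℝ} (h : IsTwist f g) (h' : IsTwist f' g') :
    IsTwist (f * f') (g * g') := by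
  have key : ∀ r s : ZMod 8, (r = 0 ∨ r = 4) → (s = 0 ∨ s = 4) →
      signMod r * signMod s = signMod (r + s) ∧ (r + s = 0 ∨ r + s = 4) := by
    unfold signMod; decide
  intro n
  rw [PowerSeries.coeff_mul, PowerSeries.coeff_mul]
  constructor
  · rw [Finset.mul_sum]
    refine Finset.sum_congr rfl fun p hp => ?_
    rw [(h _).1, (h' _).1]
    by_cases h1 : PowerSeries.coeff p.1 f = 0
    · simp [h1]
    by_cases h2 : PowerSeries.coeff p.2 f' = 0
    · simp [h2]
    rw [← mem_antidiagonal.1 hp, Nat.cast_add, ← (key _ _ ((h _).2 h1) ((h' _).2 h2)).1]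
    push_cast
    ring
  · intro hn
    obtain ⟨p, hp, hne⟩ := Finset.exists_ne_zero_of_sum_ne_zero hn
    rw [← mem_antidiagonal.1 hp, Nat.cast_add]
    exact (key _ _ ((h _).2 (left_ne_zero_of_mul hne)) ((h' _).2 (right_ne_zero_of_mul hne))).2

theorem IsTwist.pow {f g : PowerSeries ℝ} (h : IsTwist f g) (k : ℕ) : IsTwist (f ^ k) (g ^ k) := by
  induction k with
  | zero => simpa using IsTwist.one
  | succ k ih => rw [pow_succ, pow_succ]; exact ih.mul h

theorem isTwist_even {c : ℕ} (hc : Odd c) : IsTwist (evenSeries c) (twistSeries c) := by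
  have h4 : (4 : ZMod 8) * c = 4 := by
    obtain ⟨k, rfl⟩ := hc
    push_cast
    have : ∀ k : ZMod 8, 4 * (2 * k + 1) = 4 := by decide
    exact this _
  have key : ∀ x : ℤ, Even x → (4 ∣ x → ((scaledSq c x : ℕ) : ZMod 8) = 0) ∧
      (¬ 4 ∣ x → ((scaledSq c x : ℕ) : ZMod 8) = 4) := by
    intro x hx
    have hd : ∀ r : ZMod 8, (4 * r) ^ 2 = 0 := by decide
    constructor
    · rintro ⟨k, rfl⟩
      simp [scaledSq, Int.natAbs_mul, hd]
    · intro h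
      obtain ⟨y, rfl⟩ := hx
      have hy : Odd y := by
        rw [← Int.not_even_iff_odd]; rintro ⟨z, rfl⟩; exact h ⟨z, by ring⟩
      rw [← two_mul]
      rw [scaledSq, Int.natAbs_mul, Nat.cast_mul, Nat.cast_pow, Nat.cast_mul, mul_pow,
        ZMod.eight_sq_of_odd hy, mul_one, mul_comm, ← h4]
      norm_num
  intro n
  simp only [evenSeries, twistSeries, genSeries, PowerSeries.coeff_mk]
  constructor
  · rw [mul_finsum_mem]
    refine finsum_mem_congr rfl fun x hx => ?_
    by_cases hxe : Even x
    · by_cases hx4 : 4 ∣ x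
      · rw [← Set.mem_ofPred_eq.mp hx, (key x hxe).1 hx4]; simp [hx4, hxe, signMod]
      · rw [← Set.mem_ofPred_eq.mp hx, (key x hxe).2 hx4]
        simp [hx4, hxe, signMod, hxe.two_dvd]
        decide
    · have h2 : ¬ (2 ∣ x) := fun h => hxe (even_iff_two_dvd.2 h)
      have h4 : ¬ (4 ∣ x) := fun h => h2 (dvd_trans (by norm_num) h)
      simp [hxe, h2, h4]
  · intro hn
    by_contra hne
    refine hn (finsum_mem_eq_zero_of_forall_eq_zero fun x hx => ?_)
    by_contra hw
    have hxe : Even x := by by_contra h; simp [h] at hw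
    apply hne
    rw [← hx]
    by_cases hx4 : 4 ∣ x
    · exact Or.inl ((key x hxe).1 hx4)
    · exact Or.inr ((key x hxe).2 hx4)

theorem IsTwist.coeff_combination_mul {f g h : PowerSeries ℝ} {r : ZMod 8} (hfg : IsTwist f g)
    (hh : SupportedMod r h) (s : ZMod 8) (n : ℕ) :
    PowerSeries.coeff n (((signMod (s - r) : ℝ) ^ 2 • f + (signMod (s - r) : ℝ) • g) * h) =
      if (n : ZMod 8) = s then 2 * PowerSeries.coeff n (f * h) else 0 := by
  have key : ∀ r s k : ZMod 8, (k = 0 ∨ k = 4) → signMod (s - r) ^ 2 + signMod (s - r) * signMod k =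
      if k + r = s then 2 else 0 := by
    unfold signMod; decide
  have : (if (n : ZMod 8) = s then 2 * PowerSeries.coeff n (f * h) else 0) =
      (if (n : ZMod 8) = s then 2 else 0) * PowerSeries.coeff n (f * h) := by split_ifs <;> simp
  rw [this, PowerSeries.coeff_mul, PowerSeries.coeff_mul, Finset.mul_sum]
  refine Finset.sum_congr rfl fun p hp => ?_
  rw [map_add, map_smul, map_smul, smul_eq_mul, smul_eq_mul, (hfg _).1]
  by_cases h1 : PowerSeries.coeff p.1 f = 0
  · simp [h1]
  by_cases h2 : PowerSeries.coeff p.2 h = 0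
  · simp [h2]
  have h3 := key r s p.1 ((hfg _).2 h1)
  rw [← hh _ h2, ← Nat.cast_add, mem_antidiagonal.1 hp, hh _ h2] at h3
  have h4 : ((signMod (s - r) : ℝ) ^ 2 + signMod (s - r) * signMod p.1) =
      if (n : ZMod 8) = s then 2 else 0 := by
    exact_mod_cast congrArg (Int.cast (R := ℝ)) h3
  rw [← h4]
  ring

/-- The coefficient `C(a,u) C(b,v)` of the binomial expansion, or `0` at `(u, v) = (a, b)`. -/
def properChoose (a b u v : ℕ) : ℕ := if u = a ∧ v = b then 0 else a.choose u * b.choose v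

/-- The form in the theta constants `E, E'` (even), `D, D'` (twisted), `B, B'` (odd) whose value
is twice the part of `(E + B) ^ a * (E' + B') ^ b - E ^ a * E' ^ b` with exponents
`≡ a + 3b` modulo `8`. -/
noncomputable def restrictedForm {R : Type*} [CommRing R] [Algebra ℝ R] (a b : ℕ)
    (E E' D D' B B' : R) : R :=
  ∑ u ∈ range (a + 1), ∑ v ∈ range (b + 1), (properChoose a b u v : ℝ) •
    ((((signMod (u + 3 * v) : ℤ) : ℝ) ^ 2 • (E ^ u * E' ^ v) +
      ((signMod (u + 3 * v) : ℤ) : ℝ) • (D ^ u * D' ^ v)) * (B ^ (a - u) * B' ^ (b - v)))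

theorem binomial_sub {R : Type*} [CommRing R] [Algebra ℝ R] (a b : ℕ) (E E' B B' : R) :
    (E + B) ^ a * (E' + B') ^ b - E ^ a * E' ^ b =
      ∑ u ∈ range (a + 1), ∑ v ∈ range (b + 1), (properChoose a b u v : ℝ) •
        ((E ^ u * E' ^ v) * (B ^ (a - u) * B' ^ (b - v))) := by
  have h : E ^ a * E' ^ b = ∑ u ∈ range (a + 1), ∑ v ∈ range (b + 1),
      if u = a then if v = b then E ^ u * E' ^ v else 0 else 0 := by
    simp
  rw [h, add_pow, add_pow, Finset.sum_mul_sum, ← Finset.sum_sub_distrib]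
  refine Finset.sum_congr rfl fun u _ => ?_
  rw [← Finset.sum_sub_distrib]
  refine Finset.sum_congr rfl fun v _ => ?_
  by_cases hu : u = a
  · by_cases hv : v = b
    · simp [hu, hv, properChoose]
    · simp [hu, hv, properChoose, Algebra.smul_def]; ring
  · simp [hu, properChoose, Algebra.smul_def]; ring

theorem coeff_restrictedForm (a b n : ℕ) :
    PowerSeries.coeff n (restrictedForm a b (evenSeries 1) (evenSeries 3) (twistSeries 1)
      (twistSeries 3) (oddSeries 1) (oddSeries 3)) =
    if (n : ZMod 8) = a + 3 * b then 2 * (Ntilde a b n : ℝ) else 0 := by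
  rw [← coeff_Ntilde, ← even_add_odd one_pos, ← even_add_odd three_pos, binomial_sub]
  have : ∀ x : ℝ, (if (n : ZMod 8) = a + 3 * b then 2 * x else 0) =
      (if (n : ZMod 8) = a + 3 * b then 2 else 0) * x := fun x => by split_ifs <;> simp
  rw [this, restrictedForm]
  simp only [map_sum, map_smul, Finset.mul_sum, smul_eq_mul]
  refine Finset.sum_congr rfl fun u hu => ?_
  refine Finset.sum_congr rfl fun v hv => ?_
  have hs := ((supportedMod_oddSeries 1).pow (a - u)).mul ((supportedMod_oddSeries 3).pow (b - v))
  have ht := ((isTwist_even odd_one).pow u).mul ((isTwist_even (by decide : Odd 3)).pow v)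
  have := ht.coeff_combination_mul hs (a + 3 * b) n
  rw [Nat.cast_sub (by simp at hu; omega), Nat.cast_sub (by simp at hv; omega)] at this
  rw [show (a + 3 * b - (((a : ZMod 8) - u) * (1 : ℕ) + (b - v) * (3 : ℕ)) : ZMod 8) = u + 3 * v by
    push_cast; ring] at this
  rw [this]
  split_ifs <;> ring

theorem twist_eq_signed (c : ℕ) :
    twistSeries c = genSeries (scaledSq (4 * c)) fun x => if Even x then 1 else -1 := by
  apply genSeries_reindex (fun x : ℤ => 2 * x)
  · intro x y h; simpa using h
  · intro x; simp only [scaledSq, Int.natAbs_mul]; simp; ring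
  · intro x
    have : (4 ∣ 2 * x) ↔ Even x := by rw [even_iff_two_dvd]; omega
    simp [this]
  · intro y hy
    have h2 : 2 ∣ y := by
      by_contra h
      have h4 : ¬ (4 ∣ y) := by omega
      simp [h, h4] at hy
    obtain ⟨r, hr⟩ := h2
    exact ⟨r, hr.symm⟩

theorem genSeries_split {X : Type*} {Q : X → ℕ} (h : FiniteFibers Q) (w : X → ℝ) (p : X → Prop)
    [DecidablePred p] : genSeries Q w =
      genSeries Q (fun x => if p x then w x else 0) +
      genSeries Q (fun x => if p x then 0 else w x) := by
  rw [genSeries_add h]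
  congr 1
  ext x
  split_ifs <;> simp

/-- `θ(q⁴) θ(q¹²) - θ(-q⁴) θ(-q¹²)` is the product of the odd parts of `θ(q)` and `θ(q³)`. -/
theorem even_mul_even_eq :
    evenSeries 1 * evenSeries 3 = twistSeries 1 * twistSeries 3 + oddSeries 1 * oddSeries 3 := by
  have f1 := finiteFibers_scaledSq (c := 1) one_pos
  have f3 := finiteFibers_scaledSq (c := 3) three_pos
  have f4 := finiteFibers_scaledSq (c := 4 * 1) (by norm_num)
  have f12 := finiteFibers_scaledSq (c := 4 * 3) (by norm_num)
  rw [← sub_eq_iff_eq_add', even_eq_theta, even_eq_theta, twist_eq_signed, twist_eq_signed]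
  unfold thetaSeries oddSeries
  rw [genSeries_mul f4 f12, genSeries_mul f4 f12, genSeries_sub (f4.add f12),
    genSeries_mul f1 f3, genSeries_split (f1.add f3) _ (fun p => 4 ∣ p.1 - p.2)]
  have hodd : ∀ x y : ℤ, (if Odd x then (1 : ℝ) else 0) * (if Odd y then 1 else 0) =
      if Odd x ∧ Odd y then 1 else 0 := by
    intro x y; split_ifs <;> simp_all
  simp only [hodd]
  have h1 : genSeries (fun p : ℤ × ℤ => scaledSq 1 p.1 + scaledSq 3 p.2)
      (fun p => if 4 ∣ p.1 - p.2 then (if Odd p.1 ∧ Odd p.2 then (1 : ℝ) else 0) else 0) =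
      genSeries (fun p : ℤ × ℤ => scaledSq (4 * 1) p.1 + scaledSq (4 * 3) p.2)
        (fun p => if Odd (p.1 + p.2) then 1 else 0) := by
    apply genSeries_reindex (fun p : ℤ × ℤ => (p.1 + 3 * p.2, p.1 - p.2))
    · rintro ⟨x, y⟩ ⟨x', y'⟩ h
      simp only [Prod.mk.injEq] at h ⊢
      omega
    · rintro ⟨x, y⟩
      apply Int.natCast_inj.mp
      simp only [scaledSq]
      push_cast
      simp only [sq_abs]
      ring
    · rintro ⟨x, y⟩
      have h1 : (4 : ℤ) ∣ x + 3 * y - (x - y) := ⟨y, by ring⟩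
      have h2 : (Odd (x + 3 * y) ∧ Odd (x - y)) ↔ Odd (x + y) := by
        simp only [Int.odd_iff]; omega
      simp only [h1, h2, if_true]
    · rintro ⟨x, y⟩ h
      simp only [ne_eq, ite_eq_right_iff, one_ne_zero, imp_false, not_not, Classical.not_imp,
        Int.odd_iff] at h
      refine ⟨((x + 3 * y) / 4, (x - y) / 4), ?_⟩
      simp only [Prod.mk.injEq]
      omega
  have h2 : genSeries (fun p : ℤ × ℤ => scaledSq 1 p.1 + scaledSq 3 p.2)
      (fun p => if 4 ∣ p.1 - p.2 then 0 else (if Odd p.1 ∧ Odd p.2 then (1 : ℝ) else 0)) =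
      genSeries (fun p : ℤ × ℤ => scaledSq (4 * 1) p.1 + scaledSq (4 * 3) p.2)
        (fun p => if Odd (p.1 + p.2) then 1 else 0) := by
    apply genSeries_reindex (fun p : ℤ × ℤ => (p.1 + 3 * p.2, p.2 - p.1))
    · rintro ⟨x, y⟩ ⟨x', y'⟩ h
      simp only [Prod.mk.injEq] at h ⊢
      omega
    · rintro ⟨x, y⟩
      apply Int.natCast_inj.mp
      simp only [scaledSq]
      push_cast
      simp only [sq_abs]
      ring
    · rintro ⟨x, y⟩
      simp only [Int.odd_iff]
      split_ifs <;> first | rfl | omega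
    · rintro ⟨x, y⟩ h
      simp only [ne_eq, ite_eq_left_iff, ite_eq_right_iff, one_ne_zero, imp_false, not_not,
        Classical.not_imp, Int.odd_iff] at h
      refine ⟨((x - 3 * y) / 4, (x + y) / 4), ?_⟩
      simp only [Prod.mk.injEq]
      omega
  rw [h1, h2, genSeries_add (f4.add f12)]
  congr 1
  ext ⟨x, y⟩
  simp only [Int.even_iff, Int.odd_iff]
  split_ifs <;> first | omega | norm_num

/-- Jacobi's identity `θ(q⁴)⁴ - θ(-q⁴)⁴ = θ₂⁴`. -/
theorem even_pow_four {c : ℕ} (hc : 0 < c) :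
    evenSeries c ^ 4 = twistSeries c ^ 4 + oddSeries c ^ 4 := by
  have f1 := finiteFibers_scaledSq hc
  have f4 := finiteFibers_scaledSq (c := 4 * c) (by omega)
  have hp : ∀ f : PowerSeries ℝ, f ^ 4 = f * (f * (f * f)) := fun f => by ring
  rw [← sub_eq_iff_eq_add', even_eq_theta, twist_eq_signed, hp, hp, hp]
  unfold thetaSeries oddSeries
  have F1 := f1.add (f1.add (f1.add f1))
  have F4 := f4.add (f4.add (f4.add f4))
  simp only [genSeries_mul f4 f4, genSeries_mul f4 (f4.add f4),
    genSeries_mul f4 (f4.add (f4.add f4)), genSeries_mul f1 f1, genSeries_mul f1 (f1.add f1),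
    genSeries_mul f1 (f1.add (f1.add f1))]
  rw [genSeries_sub F4, genSeries_split F1 _ (fun p => 4 ∣ p.1 + p.2.1 + p.2.2.1 + p.2.2.2)]
  have hodd : ∀ x y z t : ℤ, (if Odd x then (1 : ℝ) else 0) * ((if Odd y then 1 else 0) *
      ((if Odd z then 1 else 0) * (if Odd t then 1 else 0))) =
      if Odd x ∧ Odd y ∧ Odd z ∧ Odd t then 1 else 0 := by
    intro x y z t; split_ifs <;> simp_all
  simp only [hodd]
  have h1 : genSeries (fun p : ℤ × ℤ × ℤ × ℤ =>
        scaledSq c p.1 + (scaledSq c p.2.1 + (scaledSq c p.2.2.1 + scaledSq c p.2.2.2)))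
      (fun p => if 4 ∣ p.1 + p.2.1 + p.2.2.1 + p.2.2.2 then
        (if Odd p.1 ∧ Odd p.2.1 ∧ Odd p.2.2.1 ∧ Odd p.2.2.2 then (1 : ℝ) else 0) else 0) =
      genSeries (fun p : ℤ × ℤ × ℤ × ℤ => scaledSq (4 * c) p.1 +
        (scaledSq (4 * c) p.2.1 + (scaledSq (4 * c) p.2.2.1 + scaledSq (4 * c) p.2.2.2)))
        (fun p => if Odd (p.1 + p.2.1 + p.2.2.1 + p.2.2.2) then 1 else 0) := by
    apply genSeries_reindex (fun p : ℤ × ℤ × ℤ × ℤ => (p.1 + p.2.1 + p.2.2.1 + p.2.2.2,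
      p.1 + p.2.1 - p.2.2.1 - p.2.2.2, p.1 - p.2.1 + p.2.2.1 - p.2.2.2,
      p.1 - p.2.1 - p.2.2.1 + p.2.2.2))
    · rintro ⟨x, y, z, t⟩ ⟨x', y', z', t'⟩ h
      simp only [Prod.mk.injEq] at h ⊢
      omega
    · rintro ⟨x, y, z, t⟩
      apply Int.natCast_inj.mp
      simp only [scaledSq]
      push_cast
      simp only [sq_abs]
      ring
    · rintro ⟨x, y, z, t⟩
      simp only [Int.odd_iff]
      split_ifs <;> first | rfl | omega
    · rintro ⟨x, y, z, t⟩ h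
      simp only [ne_eq, ite_eq_right_iff, one_ne_zero, imp_false, not_not, Classical.not_imp,
        Int.odd_iff] at h
      refine ⟨((x + y + z + t) / 4, (x + y - z - t) / 4, (x - y + z - t) / 4,
        (x - y - z + t) / 4), ?_⟩
      simp only [Prod.mk.injEq]
      omega
  have h2 : genSeries (fun p : ℤ × ℤ × ℤ × ℤ =>
        scaledSq c p.1 + (scaledSq c p.2.1 + (scaledSq c p.2.2.1 + scaledSq c p.2.2.2)))
      (fun p => if 4 ∣ p.1 + p.2.1 + p.2.2.1 + p.2.2.2 then 0 else
        (if Odd p.1 ∧ Odd p.2.1 ∧ Odd p.2.2.1 ∧ Odd p.2.2.2 then (1 : ℝ) else 0)) =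
      genSeries (fun p : ℤ × ℤ × ℤ × ℤ => scaledSq (4 * c) p.1 +
        (scaledSq (4 * c) p.2.1 + (scaledSq (4 * c) p.2.2.1 + scaledSq (4 * c) p.2.2.2)))
        (fun p => if Odd (p.1 + p.2.1 + p.2.2.1 + p.2.2.2) then 1 else 0) := by
    apply genSeries_reindex (fun p : ℤ × ℤ × ℤ × ℤ => (-(p.1 + p.2.1 + p.2.2.1 + p.2.2.2),
      p.1 + p.2.1 - p.2.2.1 - p.2.2.2, p.1 - p.2.1 + p.2.2.1 - p.2.2.2,
      p.1 - p.2.1 - p.2.2.1 + p.2.2.2))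
    · rintro ⟨x, y, z, t⟩ ⟨x', y', z', t'⟩ h
      simp only [Prod.mk.injEq] at h ⊢
      omega
    · rintro ⟨x, y, z, t⟩
      apply Int.natCast_inj.mp
      simp only [scaledSq]
      push_cast
      simp only [sq_abs]
      ring
    · rintro ⟨x, y, z, t⟩
      simp only [Int.odd_iff]
      split_ifs <;> first | rfl | omega
    · rintro ⟨x, y, z, t⟩ h
      simp only [ne_eq, ite_eq_left_iff, ite_eq_right_iff, one_ne_zero, imp_false, not_not,
        Classical.not_imp, Int.odd_iff] at h
      refine ⟨((-x + y + z + t) / 4, (-x + y - z - t) / 4, (-x - y + z - t) / 4,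
        (-x - y - z + t) / 4), ?_⟩
      simp only [Prod.mk.injEq]
      omega
  rw [h1, h2, genSeries_add F4]
  congr 1
  ext ⟨x, y, z, t⟩
  simp only [Int.even_iff, Int.odd_iff]
  split_ifs <;> first | omega | norm_num

theorem exists_const_of_restrictedForm {a b : ℕ} {K : ℚ} (hK : K ≠ 0)
    (h : restrictedForm a b (evenSeries 1) (evenSeries 3) (twistSeries 1)
      (twistSeries 3) (oddSeries 1) (oddSeries 3) =
        (2 * K : ℝ) • (oddSeries 1 ^ a * oddSeries 3 ^ b)) :
    ∃ C : ℚ, ∀ n : ℕ, (Nstar a b (8 * (n : ℤ) + a + 3 * b) : ℚ) =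
      C * (Ntilde a b (8 * (n : ℤ) + a + 3 * b) : ℚ) := by
  refine ⟨K⁻¹, fun n => ?_⟩
  have h1 := coeff_restrictedForm a b (8 * n + a + 3 * b)
  have h8 : ((8 : ℕ) : ZMod 8) = 0 := ZMod.natCast_self 8
  rw [h, if_pos (by push_cast; rw [show (8 : ZMod 8) = 0 from h8]; ring), map_smul, smul_eq_mul,
    coeff_odd] at h1
  have h2 : (K : ℝ) * (Nstar a b ((8 * n + a + 3 * b : ℕ) : ℤ) : ℝ) =
    (Ntilde a b ((8 * n + a + 3 * b : ℕ) : ℤ) : ℝ) := by linarith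
  have h3 : K * (Nstar a b ((8 * n + a + 3 * b : ℕ) : ℤ) : ℚ) =
    (Ntilde a b ((8 * n + a + 3 * b : ℕ) : ℤ) : ℚ) := by exact_mod_cast h2
  push_cast at h3
  rw [← h3]
  field_simp

theorem exists_const_of_mem {a b : ℕ} (h : (a, b) ∈ ({(0, 4), (0, 8), (1, 1), (1, 5), (2, 2),
    (4, 0), (5, 1), (8, 0)} : Set (ℕ × ℕ))) :
    ∃ C : ℚ, ∀ n : ℕ, (Nstar a b (8 * (n : ℤ) + a + 3 * b) : ℚ) =
      C * (Ntilde a b (8 * (n : ℤ) + a + 3 * b) : ℚ) := by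
  have e1 := even_pow_four one_pos
  have e3 := even_pow_four three_pos
  have e13 := even_mul_even_eq
  have sgn : signMod 0 = 1 ∧ signMod 1 = 0 ∧ signMod 2 = 0 ∧ signMod 3 = 0 ∧ signMod 4 = -1 ∧
    signMod 5 = 0 ∧ signMod 6 = 0 ∧ signMod 7 = 0 ∧ signMod 8 = 1 ∧ signMod 9 = 0 ∧ signMod 10 = 0 ∧
    signMod 11 = 0 ∧ signMod 12 = -1 ∧ signMod 13 = 0 ∧ signMod 14 = 0 ∧ signMod 15 = 0 ∧
    signMod 16 = 1 ∧ signMod 17 = 0 ∧ signMod 18 = 0 ∧ signMod 19 = 0 ∧ signMod 20 = -1 ∧ signMod 21 = 0 ∧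
    signMod 22 = 0 ∧ signMod 23 = 0 ∧ signMod 24 = 1 ∧ signMod 25 = 0 ∧ signMod 26 = 0 ∧
    signMod 27 = 0 ∧ signMod 28 = -1 := by decide
  have hC : ∀ x : ℝ, PowerSeries.C x = algebraMap ℝ (PowerSeries ℝ) x := fun _ => rfl
  simp only [Set.mem_insert_iff, Set.mem_singleton_iff, Prod.mk.injEq] at h
  have key : ∀ K : ℚ, K ≠ 0 → restrictedForm a b (evenSeries 1) (evenSeries 3) (twistSeries 1)
      (twistSeries 3) (oddSeries 1) (oddSeries 3) =
        (2 * K : ℝ) • (oddSeries 1 ^ a * oddSeries 3 ^ b) → _ := fun K hK =>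
    exists_const_of_restrictedForm (a := a) (b := b) hK
  rcases h with ⟨rfl, rfl⟩ | ⟨rfl, rfl⟩ | ⟨rfl, rfl⟩ | ⟨rfl, rfl⟩ | ⟨rfl, rfl⟩ | ⟨rfl, rfl⟩ |
    ⟨rfl, rfl⟩ | ⟨rfl, rfl⟩
  · apply key 1 (by norm_num)
    norm_num [restrictedForm, Finset.sum_range_succ, properChoose, Nat.choose, Algebra.smul_def, sgn]
    simp only [hC, map_ofNat, true_or]
  · apply key 36 (by norm_num)
    norm_num [restrictedForm, Finset.sum_range_succ, properChoose, Nat.choose, Algebra.smul_def, sgn]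
    simp only [hC, map_ofNat]
    linear_combination 70 * oddSeries 3 ^ 4 * e3
  · apply key 1 (by norm_num)
    norm_num [restrictedForm, Finset.sum_range_succ, properChoose, Nat.choose, Algebra.smul_def, sgn]
    simp only [hC, map_ofNat, true_or]
  · apply key 6 (by norm_num)
    norm_num [restrictedForm, Finset.sum_range_succ, properChoose, Nat.choose, Algebra.smul_def, sgn]
    simp only [hC, map_ofNat]
    linear_combination 5 * oddSeries 3 ^ 4 * e13 + 5 * oddSeries 1 * oddSeries 3 * e3
  · apply key 3 (by norm_num)
    norm_num [restrictedForm, Finset.sum_range_succ, properChoose, Nat.choose, Algebra.smul_def, sgn]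
    simp only [hC, map_ofNat]
    linear_combination 4 * oddSeries 1 * oddSeries 3 * e13
  · apply key 1 (by norm_num)
    norm_num [restrictedForm, Finset.sum_range_succ, properChoose, Nat.choose, Algebra.smul_def, sgn]
    simp only [hC, map_ofNat, true_or]
  · apply key 6 (by norm_num)
    norm_num [restrictedForm, Finset.sum_range_succ, properChoose, Nat.choose, Algebra.smul_def, sgn]
    simp only [hC, map_ofNat]
    linear_combination 5 * oddSeries 1 ^ 4 * e13 + 5 * oddSeries 1 * oddSeries 3 * e1
  · apply key 36 (by norm_num)
    norm_num [restrictedForm, Finset.sum_range_succ, properChoose, Nat.choose, Algebra.smul_def, sgn]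
    simp only [hC, map_ofNat]
    linear_combination 70 * oddSeries 1 ^ 4 * e1

theorem signMod_sq (m : ℕ) : ((signMod m : ℤ) : ℝ) ^ 2 = if 4 ∣ m then 1 else 0 := by
  have h : ∀ r : ZMod 8, signMod r ^ 2 = if r = 0 ∨ r = 4 then 1 else 0 := by decide
  have h4 : ((m : ZMod 8) = 0 ∨ (m : ZMod 8) = 4) ↔ 4 ∣ m := by
    rw [show (4 : ZMod 8) = ((4 : ℕ) : ZMod 8) from rfl, ZMod.natCast_eq_natCast_iff,
      ZMod.natCast_eq_zero_iff, Nat.ModEq]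
    omega
  have := h m
  simp only [h4] at this
  exact_mod_cast this

theorem fourth_roots_sum (m : ℕ) :
    (1 : ℂ) + (-1) ^ m + Complex.I ^ m + (-Complex.I) ^ m = if 4 ∣ m then 4 else 0 := by
  obtain ⟨k, hk⟩ : ∃ k, m = 4 * k + m % 4 := ⟨m / 4, by omega⟩
  have h : ∀ z : ℂ, z ^ 4 = 1 → z ^ m = z ^ (m % 4) := fun z hz => by
    conv_lhs => rw [hk, pow_add, pow_mul, hz, one_pow, one_mul]
  have hI : (-Complex.I) ^ 4 = 1 := by rw [Even.neg_pow (by decide), Complex.I_pow_four]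
  rw [h (-1) (by norm_num), h _ Complex.I_pow_four, h _ hI]
  have hlt : m % 4 < 4 := Nat.mod_lt _ (by norm_num)
  simp only [Nat.dvd_iff_mod_eq_zero]
  generalize m % 4 = r at hlt
  interval_cases r <;> (simp [pow_succ]; try norm_num)

/-- The sum of `a.choose u * b.choose v` over `u + 3 * v` divisible by `4`. -/
noncomputable def chooseSum (a b : ℕ) : ℝ :=
  ∑ u ∈ range (a + 1), ∑ v ∈ range (b + 1),
    (a.choose u * b.choose v : ℝ) * if 4 ∣ u + 3 * v then 1 else 0

theorem sum_choose_mul_pow (a b : ℕ) (z : ℂ) :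
    ∑ u ∈ range (a + 1), ∑ v ∈ range (b + 1), (a.choose u * b.choose v : ℂ) * z ^ (u + 3 * v) =
      (1 + z) ^ a * (1 + z ^ 3) ^ b := by
  rw [add_comm 1 z, add_comm 1 (z ^ 3), add_pow, add_pow, Finset.sum_mul_sum]
  refine Finset.sum_congr rfl fun u _ => Finset.sum_congr rfl fun v _ => ?_
  rw [one_pow, one_pow, pow_add, pow_mul]
  ring

theorem le_chooseSum (a b h : ℕ) (hh : a + b = 2 * h) (hpos : 0 < a + b) :
    4 ^ h - 2 * 2 ^ h ≤ 4 * chooseSum a b := by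
  have key : (4 * chooseSum a b : ℂ) = 2 ^ a * 2 ^ b + (1 + Complex.I) ^ a *
      (1 - Complex.I) ^ b + (1 - Complex.I) ^ a * (1 + Complex.I) ^ b := by
    have h1 := sum_choose_mul_pow a b 1
    have h2 := sum_choose_mul_pow a b (-1)
    have h3 := sum_choose_mul_pow a b Complex.I
    have h4 := sum_choose_mul_pow a b (-Complex.I)
    have hz : (0 : ℂ) ^ a * 0 ^ b = 0 := by rw [← pow_add]; exact zero_pow (by omega)
    have e1 : (1 : ℂ) + 1 ^ 3 = 2 := by norm_num
    have e2 : (1 : ℂ) + (-1) ^ 3 = 0 := by norm_num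
    have e2' : (1 : ℂ) + (-1) = 0 := by norm_num
    have e3 : (1 : ℂ) + Complex.I ^ 3 = 1 - Complex.I := by
      rw [Complex.I_pow_three]; ring
    have e4 : (1 : ℂ) + (-Complex.I) ^ 3 = 1 + Complex.I := by
      rw [Odd.neg_pow (by decide), Complex.I_pow_three]; ring
    rw [e1, one_add_one_eq_two] at h1
    rw [e2, e2', hz] at h2
    rw [e3] at h3
    rw [e4, ← sub_eq_add_neg] at h4
    rw [← h1, ← h3, ← h4, ← add_zero (Finset.sum _ _), ← h2]
    simp only [chooseSum, ← Finset.sum_add_distrib, Complex.ofReal_sum, Finset.mul_sum]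
    refine Finset.sum_congr rfl fun u _ => Finset.sum_congr rfl fun v _ => ?_
    have := fourth_roots_sum (u + 3 * v)
    rw [← mul_add, ← mul_add, ← mul_add, one_pow, this]
    split_ifs <;> push_cast <;> ring
  have hn : ∀ c d : ℕ, c + d = 2 * h →
      ‖(1 + Complex.I) ^ c * (1 - Complex.I) ^ d‖ = 2 ^ h := by
    intro c d hcd
    have n1 : ‖1 + Complex.I‖ = √2 := by
      rw [Complex.norm_eq_sqrt_sq_add_sq]; norm_num
    have n2 : ‖1 - Complex.I‖ = √2 := by
      rw [Complex.norm_eq_sqrt_sq_add_sq]; norm_num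
    rw [norm_mul, norm_pow, norm_pow, n1, n2, ← pow_add, hcd, pow_mul,
      Real.sq_sqrt (by norm_num)]
  have h2 : (2 : ℂ) ^ a * 2 ^ b = 4 ^ h := by
    rw [← pow_add, hh, pow_mul]; norm_num
  rw [h2] at key
  have hre := congrArg Complex.re key
  have hl : (4 * chooseSum a b : ℂ).re = 4 * chooseSum a b := by
    rw [← Complex.ofReal_ofNat, ← Complex.ofReal_mul, Complex.ofReal_re]
  have hr : ((4 : ℂ) ^ h).re = 4 ^ h := by
    rw [← Complex.ofReal_ofNat, ← Complex.ofReal_pow, Complex.ofReal_re]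
  rw [Complex.add_re, Complex.add_re, hl, hr] at hre
  have b1 := (abs_le.1 ((Complex.abs_re_le_norm _).trans_eq (hn a b hh))).1
  have b2 := (abs_le.1 ((Complex.abs_re_le_norm _).trans_eq (hn b a (by omega)))).1
  rw [mul_comm] at b2
  linarith

theorem chooseSum_symm {a b : ℕ} (hmod : 4 ∣ a + 3 * b) :
    ∑ u ∈ range (a + 1), ∑ v ∈ range (b + 1),
      (a.choose u * b.choose v : ℝ) * ((if 4 ∣ u + 3 * v then 1 else 0) * (4 * v - 2 * b)) = 0 := by
  have h : ∀ s : ℝ, s = -s → s = 0 := fun s hs => by linarith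
  apply h
  conv_lhs => rw [← Finset.sum_range_reflect]
  rw [← Finset.sum_neg_distrib]
  refine Finset.sum_congr rfl fun u hu => ?_
  rw [← Finset.sum_range_reflect, ← Finset.sum_neg_distrib]
  refine Finset.sum_congr rfl fun v hv => ?_
  have hu : u ≤ a := by simpa [Nat.lt_succ_iff] using hu
  have hv : v ≤ b := by simpa [Nat.lt_succ_iff] using hv
  simp only [Nat.add_sub_cancel]
  rw [Nat.choose_symm hu, Nat.choose_symm hv, Nat.cast_sub hv]
  have : 4 ∣ a - u + 3 * (b - v) ↔ 4 ∣ u + 3 * v := by omega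
  simp only [this]
  ring

theorem mem_of_chooseSum_le {a b : ℕ} (hb : 0 < b) (hpar : Even (a + b)) (hmod : 4 ∣ a + 3 * b)
    (hle : 2 * b * chooseSum a b ≤ 4 * b + 4 * a * b + 16 * b.choose 4) :
    (a, b) ∈ ({(0, 4), (0, 8), (1, 1), (1, 5), (2, 2), (4, 0), (5, 1), (8, 0)} :
        Set (ℕ × ℕ)) := by
  obtain ⟨h, hh⟩ := hpar
  have hM := le_chooseSum a b h (by omega) (by omega)
  have h1 : (b : ℝ) * (4 ^ h - 2 * 2 ^ h) ≤ 8 * b + 8 * a * b + 32 * b.choose 4 := by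
    nlinarith [mul_le_mul_of_nonneg_left hM (Nat.cast_nonneg (α := ℝ) b)]
  have h2 : b * 4 ^ h ≤ 8 * b + 8 * a * b + 32 * b.choose 4 + b * (2 * 2 ^ h) := by
    rw [mul_sub] at h1
    have h1 := sub_le_iff_le_add.1 h1
    exact_mod_cast h1
  have hlt : h < 6 := by
    by_contra hlt
    push Not at hlt
    have hc : 24 * b.choose 4 ≤ b * (b * b * b) := by
      have := Nat.choose_le_pow_div (α := ℚ) 4 b
      rw [le_div_iff₀ (by positivity)] at this
      have h24 : (Nat.factorial 4) = 24 := rfl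
      rw [h24] at this
      have : b.choose 4 * 24 ≤ b ^ 4 := by exact_mod_cast this
      nlinarith
    have hcub : ∀ k : ℕ, 24 * (k + 1 + 6) + 48 * (k + 1 + 6) + 32 * (k + 1 + 6) ^ 3 ≤
        4 * (24 * (k + 6) + 48 * (k + 6) + 32 * (k + 6) ^ 3) := by
      intro k
      clear * -
      ring_nf
      linarith [Nat.zero_le (k ^ 3), Nat.zero_le (k ^ 2)]
    have hp : ∀ k, 24 * (k + 6) + 48 * (k + 6) + 32 * (k + 6) ^ 3 + 6 * 2 ^ (k + 6) <
        3 * 4 ^ (k + 6) := by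
      intro k
      induction k with
      | zero => norm_num
      | succ k ih =>
        have e1 : (2 : ℕ) ^ (k + 1 + 6) = 2 * 2 ^ (k + 6) := by ring
        have e2 : (4 : ℕ) ^ (k + 1 + 6) = 4 * 4 ^ (k + 6) := by ring
        have e3 := hcub k
        rw [e1, e2]
        linarith [Nat.zero_le (2 ^ (k + 6))]
    obtain ⟨k, rfl⟩ := Nat.exists_eq_add_of_le' hlt
    have hp := hp k
    have hb3 : b * b * b ≤ 8 * (k + 6) ^ 3 := by
      have : b ≤ 2 * (k + 6) := by omega
      calc b * b * b = b ^ 3 := by ring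
        _ ≤ (2 * (k + 6)) ^ 3 := Nat.pow_le_pow_left this 3
        _ = _ := by ring
    have ha : a ≤ 2 * (k + 6) := by omega
    have h3 : b * (3 * 4 ^ (k + 6)) ≤ b * (24 + 24 * a + 4 * (b * b * b) + 6 * 2 ^ (k + 6)) := by
      nlinarith
    have h4 := Nat.le_of_mul_le_mul_left h3 hb
    omega
  have ha : a ≤ 10 := by omega
  have hb' : b ≤ 10 := by omega
  simp only [Set.mem_insert_iff, Set.mem_singleton_iff, Prod.mk.injEq]
  interval_cases a <;> interval_cases b <;> first | omega | (interval_cases h <;> simp_all [Nat.choose])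

open Filter Topology in
/-- `f` has the expansion `c + d * s ^ 4 + o (s ^ 4)` as `s` tends to `0` from the right. -/
def HasExpansion (f : ℝ → ℝ) (c d : ℝ) : Prop :=
  Tendsto (fun s => (f s - c) / s ^ 4) (𝓝[>] 0) (𝓝 d)

namespace HasExpansion

open Filter Topology

variable {f g : ℝ → ℝ} {c d c' d' : ℝ}

theorem const (c : ℝ) : HasExpansion (fun _ => c) c 0 := by simp [HasExpansion]

theorem congr (h : HasExpansion f c d) (hc : c = c') (hd : d = d') : HasExpansion f c' d' := by
  rwa [← hc, ← hd]

theorem tendsto (h : HasExpansion f c d) : Tendsto f (𝓝[>] 0) (𝓝 c) := by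
  have h0 : Tendsto (fun s : ℝ => s ^ 4) (𝓝[>] 0) (𝓝 0) := by
    have : Tendsto (fun s : ℝ => s ^ 4) (𝓝 0) (𝓝 (0 ^ 4)) := (continuous_pow 4).tendsto 0
    rw [zero_pow (by norm_num)] at this
    exact this.mono_left nhdsWithin_le_nhds
  have h1 := (Tendsto.mul h h0).add_const c
  rw [mul_zero, zero_add] at h1
  refine h1.congr' ?_
  filter_upwards [self_mem_nhdsWithin] with s hs
  have : s ≠ 0 := ne_of_gt hs
  field_simp
  ring

theorem add (h : HasExpansion f c d) (h' : HasExpansion g c' d') :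
    HasExpansion (fun s => f s + g s) (c + c') (d + d') := by
  refine (Tendsto.add h h').congr fun s => ?_
  ring

theorem mul (h : HasExpansion f c d) (h' : HasExpansion g c' d') :
    HasExpansion (fun s => f s * g s) (c * c') (d * c' + c * d') := by
  refine ((Tendsto.mul h h'.tendsto).add (Tendsto.const_mul c h')).congr fun s => ?_
  ring

theorem const_mul (h : HasExpansion f c d) (k : ℝ) :
    HasExpansion (fun s => k * f s) (k * c) (k * d) :=
  ((const k).mul h).congr rfl (by ring)

theorem sub (h : HasExpansion f c d) (h' : HasExpansion g c' d') :
    HasExpansion (fun s => f s - g s) (c - c') (d - d') := by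
  refine (Tendsto.sub h h').congr fun s => ?_
  ring

theorem pow (h : HasExpansion f 1 d) (k : ℕ) : HasExpansion (fun s => f s ^ k) 1 (k * d) := by
  induction k with
  | zero => simpa using const 1
  | succ k ih =>
    simp only [pow_succ]
    exact (ih.mul h).congr (by ring) (by push_cast; ring)

theorem sum {ι : Type*} (t : Finset ι) {f : ι → ℝ → ℝ} {c d : ι → ℝ}
    (h : ∀ i ∈ t, HasExpansion (f i) (c i) (d i)) :
    HasExpansion (fun s => ∑ i ∈ t, f i s) (∑ i ∈ t, c i) (∑ i ∈ t, d i) := by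
  refine (tendsto_finsetSum t h).congr fun s => ?_
  rw [← Finset.sum_div, Finset.sum_sub_distrib]

end HasExpansion

/-- The theta function `∑ x ^ (n²)` over the integers. -/
noncomputable def thetaSum (x : ℝ) : ℝ := ∑' n : ℤ, x ^ (n.natAbs ^ 2)

section

open Filter Topology

theorem summable_pow_sq_add {x : ℝ} (hx : x ∈ Set.Ico 0 1) :
    Summable fun n : ℕ => x ^ (n ^ 2 + 2 * n) := by
  refine Summable.of_nonneg_of_le (fun n => pow_nonneg hx.1 _) (fun n => ?_)
    (summable_geometric_of_lt_one hx.1 hx.2)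
  exact pow_le_pow_of_le_one hx.1 hx.2.le (by nlinarith)

theorem hasSum_thetaSum {x : ℝ} (hx : x ∈ Set.Ico 0 1) :
    HasSum (fun n : ℤ => x ^ (n.natAbs ^ 2)) (1 + 2 * (x * ∑' n : ℕ, x ^ (n ^ 2 + 2 * n))) := by
  have h := (summable_pow_sq_add hx).hasSum.mul_left x
  have h1 : ∀ n : ℕ, x * x ^ (n ^ 2 + 2 * n) = x ^ (((n : ℤ) + 1).natAbs ^ 2) := fun n => by
    rw [← pow_succ', show ((n : ℤ) + 1).natAbs = n + 1 by omega]
    congr 1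
    ring
  have h2 : ∀ n : ℕ, x * x ^ (n ^ 2 + 2 * n) = x ^ ((-((n : ℤ) + 1)).natAbs ^ 2) := fun n => by
    rw [h1, Int.natAbs_neg]
  have := HasSum.of_add_one_of_neg_add_one (f := fun n : ℤ => x ^ (n.natAbs ^ 2))
    (by simpa only [h1] using h) (by simpa only [h2] using h)
  convert this using 1
  simp
  ring

theorem tendsto_thetaSum_sub_one_div :
    Tendsto (fun x => (thetaSum x - 1) / x) (𝓝[>] 0) (𝓝 2) := by
  have h : Tendsto (fun x : ℝ => ∑' n : ℕ, x ^ (n ^ 2 + 2 * n)) (𝓝[>] 0)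
      (𝓝 (∑' n : ℕ, if n = 0 then 1 else 0)) := by
    refine tendsto_tsum_of_dominated_convergence (bound := fun n : ℕ => (1 / 2 : ℝ) ^ n)
      (summable_geometric_of_lt_one (by norm_num) (by norm_num)) (fun n => ?_) ?_
    · have : Tendsto (fun x : ℝ => x ^ (n ^ 2 + 2 * n)) (𝓝 0) (𝓝 (0 ^ (n ^ 2 + 2 * n))) :=
        (continuous_pow _).tendsto 0
      rw [zero_pow_eq] at this
      refine (this.mono_left nhdsWithin_le_nhds).congr' ?_ |>.trans ?_
      · rfl
      · simp
    · filter_upwards [Ioo_mem_nhdsGT (show (0 : ℝ) < 1 / 2 by norm_num)] with x hx n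
      rw [Real.norm_of_nonneg (pow_nonneg hx.1.le _)]
      exact (pow_le_pow_of_le_one hx.1.le (by linarith [hx.2]) (by nlinarith)).trans
        (pow_le_pow_left₀ hx.1.le hx.2.le n)
  rw [tsum_ite_eq] at h
  have h2 := h.const_mul 2
  rw [mul_one] at h2
  refine h2.congr' ?_
  filter_upwards [Ioo_mem_nhdsGT one_pos] with x hx
  rw [thetaSum, (hasSum_thetaSum ⟨hx.1.le, hx.2⟩).tsum_eq]
  have := hx.1.ne'
  field_simp
  ring

theorem tendsto_pow_nhdsGT {k : ℕ} (hk : k ≠ 0) :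
    Tendsto (fun s : ℝ => s ^ k) (𝓝[>] 0) (𝓝[>] 0) := by
  refine tendsto_nhdsWithin_iff.2 ⟨?_, ?_⟩
  · have : Tendsto (fun s : ℝ => s ^ k) (𝓝 0) (𝓝 (0 ^ k)) := (continuous_pow k).tendsto 0
    rw [zero_pow hk] at this
    exact this.mono_left nhdsWithin_le_nhds
  · filter_upwards [self_mem_nhdsWithin] with s hs using Set.mem_Ioi.2 (pow_pos (Set.mem_Ioi.1 hs) k)

theorem tendsto_thetaSum_pow {k : ℕ} (hk : k ≠ 0) :
    Tendsto (fun s => (thetaSum (s ^ k) - 1) / s ^ k) (𝓝[>] 0) (𝓝 2) :=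
  tendsto_thetaSum_sub_one_div.comp (tendsto_pow_nhdsGT hk)

theorem tendsto_thetaSum_pow_add {k m : ℕ} (hm : m ≠ 0) :
    Tendsto (fun s => (thetaSum (s ^ (k + m)) - 1) / s ^ k) (𝓝[>] 0) (𝓝 0) := by
  have := (tendsto_thetaSum_pow (k := k + m) (by omega)).mul
    ((tendsto_pow_nhdsGT hm).mono_right nhdsWithin_le_nhds)
  rw [mul_zero] at this
  refine this.congr' ?_
  filter_upwards [self_mem_nhdsWithin] with s hs
  have : s ≠ 0 := ne_of_gt hs
  rw [pow_add]
  field_simp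

theorem hasExpansion_thetaSum_four : HasExpansion (fun s => thetaSum (s ^ 4)) 1 2 :=
  tendsto_thetaSum_pow (by norm_num)

theorem hasExpansion_thetaSum_of_lt {k : ℕ} (hk : 4 < k) :
    HasExpansion (fun s => thetaSum (s ^ k)) 1 0 := by
  obtain ⟨m, rfl⟩ := Nat.exists_eq_add_of_lt hk
  exact tendsto_thetaSum_pow_add (k := 4) (m := m + 1) (by omega)

theorem tendsto_thetaSum_sub_div {k m : ℕ} (hk : k ≠ 0) (hm : m ≠ 0) :
    Tendsto (fun s => (thetaSum (s ^ k) - thetaSum (s ^ (k + m))) / s ^ k) (𝓝[>] 0) (𝓝 2) := by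
  have := (tendsto_thetaSum_pow hk).sub (tendsto_thetaSum_pow_add (k := k) hm)
  rw [sub_zero] at this
  refine this.congr fun s => ?_
  ring

/-- The first order coefficient of `δ ^ u * δ' ^ v` when `δ = 2 s ^ 3 + o (s ^ 3)` and
`δ' = 2 s + o (s)`. -/
def twistCoeff (u v : ℕ) : ℝ := if 3 * u + v = 4 then 2 ^ (u + v) else 0

theorem hasExpansion_twist {u v : ℕ} (h : 4 ∣ u + 3 * v) :
    HasExpansion (fun s => (thetaSum (s ^ 3) - thetaSum (s ^ 12)) ^ u *
      (thetaSum (s ^ 1) - thetaSum (s ^ 4)) ^ v) (if u = 0 ∧ v = 0 then 1 else 0)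
      (twistCoeff u v) := by
  by_cases h0 : u = 0 ∧ v = 0
  · obtain ⟨rfl, rfl⟩ := h0
    simpa [twistCoeff] using HasExpansion.const 1
  rw [if_neg h0, HasExpansion]
  obtain ⟨m, hm⟩ : ∃ m, 3 * u + v = 4 + m := ⟨3 * u + v - 4, by omega⟩
  have h1 := ((tendsto_thetaSum_sub_div (k := 3) (m := 9) (by norm_num) (by norm_num)).pow u).mul
    ((tendsto_thetaSum_sub_div (k := 1) (m := 3) (by norm_num) (by norm_num)).pow v)
  have h2 : Tendsto (fun s : ℝ => s ^ m) (𝓝[>] 0) (𝓝 (0 ^ m)) :=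
    ((continuous_pow m).tendsto 0).mono_left nhdsWithin_le_nhds
  have h3 := h1.mul h2
  have h4 : (2 : ℝ) ^ u * 2 ^ v * 0 ^ m = twistCoeff u v := by
    rw [twistCoeff, zero_pow_eq, pow_add]
    have : m = 0 ↔ 3 * u + v = 4 := by omega
    simp [this]
  rw [h4] at h3
  refine h3.congr' ?_
  filter_upwards [self_mem_nhdsWithin] with s hs
  have hs : s ≠ 0 := ne_of_gt hs
  have e : (s ^ 3) ^ u * (s ^ 1) ^ v = s ^ 4 * s ^ m := by
    rw [← pow_mul, ← pow_mul, ← pow_add, ← pow_add, one_mul, hm]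
  simp only [div_pow]
  rw [div_mul_div_comm, e, sub_zero]
  field_simp

end

theorem sum_properChoose_mul (a b : ℕ) (F : ℕ → ℕ → ℝ) :
    ∑ u ∈ range (a + 1), ∑ v ∈ range (b + 1), (properChoose a b u v : ℝ) * F u v =
      ∑ u ∈ range (a + 1), ∑ v ∈ range (b + 1), (a.choose u * b.choose v : ℝ) * F u v - F a b := by
  have h : F a b = ∑ u ∈ range (a + 1), ∑ v ∈ range (b + 1),
      if u = a then if v = b then F u v else 0 else 0 := by
    simp
  rw [h, ← Finset.sum_sub_distrib]
  refine Finset.sum_congr rfl fun u _ => ?_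
  rw [← Finset.sum_sub_distrib]
  refine Finset.sum_congr rfl fun v _ => ?_
  by_cases hu : u = a
  · by_cases hv : v = b
    · simp [hu, hv, properChoose]
    · simp [hu, hv, properChoose]
  · simp [hu, properChoose]

theorem sum_properChoose_mul_ite {a b : ℕ} (hab : 0 < a + b) (x : ℝ) :
    ∑ u ∈ range (a + 1), ∑ v ∈ range (b + 1),
      (properChoose a b u v : ℝ) * (if u = 0 ∧ v = 0 then x else 0) = x := by
  rw [sum_properChoose_mul, if_neg (by omega), sub_zero]
  simp [ite_and]

/-- The contribution of the twisted theta constants to the first order coefficient of the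
restricted form. -/
noncomputable def twistSum (a b : ℕ) : ℝ :=
  ∑ u ∈ range (a + 1), ∑ v ∈ range (b + 1),
    (properChoose a b u v : ℝ) * (signMod (u + 3 * v) * twistCoeff u v)

theorem le_twistSum (a b : ℕ) : -(4 * a * b + 16 * b.choose 4 : ℝ) ≤ twistSum a b := by
  have h1 : ∑ u ∈ range (a + 1), ∑ v ∈ range (b + 1),
      (if u = 1 then if v = 1 then (4 * a * b : ℝ) else 0 else 0) ≤ 4 * a * b := by
    rcases Nat.eq_zero_or_pos a with rfl | ha
    · simp
    · rcases Nat.eq_zero_or_pos b with rfl | hb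
      · simp
      · simp [ha, hb]
  have h2 : ∑ u ∈ range (a + 1), ∑ v ∈ range (b + 1),
      (if u = 0 then if v = 4 then (16 * b.choose 4 : ℝ) else 0 else 0) ≤ 16 * b.choose 4 := by
    simp only [Finset.sum_ite_irrel, Finset.sum_const_zero, Finset.sum_ite_eq']
    split_ifs <;> simp
  have h3 : -(∑ u ∈ range (a + 1), ∑ v ∈ range (b + 1),
      (if u = 1 then if v = 1 then (4 * a * b : ℝ) else 0 else 0) +
      ∑ u ∈ range (a + 1), ∑ v ∈ range (b + 1),
      (if u = 0 then if v = 4 then (16 * b.choose 4 : ℝ) else 0 else 0)) ≤ twistSum a b := by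
    rw [← Finset.sum_add_distrib, ← Finset.sum_neg_distrib]
    refine Finset.sum_le_sum fun u _ => ?_
    rw [← Finset.sum_add_distrib, ← Finset.sum_neg_distrib]
    refine Finset.sum_le_sum fun v _ => ?_
    have hs4 : signMod 4 = -1 := by decide
    have hs12 : signMod 12 = -1 := by decide
    by_cases h11 : u = 1 ∧ v = 1
    · obtain ⟨rfl, rfl⟩ := h11
      norm_num [twistCoeff, properChoose, hs4]
      split_ifs
      · positivity
      · linarith
    · by_cases h04 : u = 0 ∧ v = 4
      · obtain ⟨rfl, rfl⟩ := h04
        norm_num [twistCoeff, properChoose, hs12]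
        split_ifs
        · positivity
        · linarith
      · have : ¬ (3 * u + v = 4) := by omega
        have e1 : (if u = 1 then if v = 1 then (4 * a * b : ℝ) else 0 else 0) = 0 := by
          rw [← ite_and, if_neg h11]
        have e2 : (if u = 0 then if v = 4 then (16 * b.choose 4 : ℝ) else 0 else 0) = 0 := by
          rw [← ite_and, if_neg h04]
        simp [twistCoeff, this, e1, e2]
  linarith

theorem hasExpansion_restrictedForm {a b : ℕ} (hab : 0 < a + b) (hmod : 4 ∣ a + 3 * b) :
    HasExpansion (fun s => restrictedForm a b (thetaSum (s ^ 12)) (thetaSum (s ^ 4))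
      (thetaSum (s ^ 3) - thetaSum (s ^ 12)) (thetaSum (s ^ 1) - thetaSum (s ^ 4))
      (2 * thetaSum (s ^ 48) - thetaSum (s ^ 12)) (2 * thetaSum (s ^ 16) - thetaSum (s ^ 4)))
      (chooseSum a b) (twistSum a b - 4 * b) := by
  have hE : HasExpansion (fun s => thetaSum (s ^ 12)) 1 0 := hasExpansion_thetaSum_of_lt (by norm_num)
  have hE' := hasExpansion_thetaSum_four
  have hB : HasExpansion (fun s => 2 * thetaSum (s ^ 48) - thetaSum (s ^ 12)) 1 0 :=
    (((hasExpansion_thetaSum_of_lt (by norm_num)).const_mul 2).sub hE).congr (by norm_num)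
      (by norm_num)
  have hB' : HasExpansion (fun s => 2 * thetaSum (s ^ 16) - thetaSum (s ^ 4)) 1 (-2) :=
    (((hasExpansion_thetaSum_of_lt (by norm_num)).const_mul 2).sub hE').congr (by norm_num)
      (by norm_num)
  have hs : ∀ u v : ℕ, (u : ZMod 8) + 3 * v = ((u + 3 * v : ℕ) : ZMod 8) := fun u v => by
    push_cast; rfl
  have key : ∀ u ∈ range (a + 1), ∀ v ∈ range (b + 1), HasExpansion
      (fun s => (properChoose a b u v : ℝ) •
        ((((signMod (u + 3 * v) : ℤ) : ℝ) ^ 2 • (thetaSum (s ^ 12) ^ u * thetaSum (s ^ 4) ^ v) +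
        ((signMod (u + 3 * v) : ℤ) : ℝ) • ((thetaSum (s ^ 3) - thetaSum (s ^ 12)) ^ u *
          (thetaSum (s ^ 1) - thetaSum (s ^ 4)) ^ v)) *
        ((2 * thetaSum (s ^ 48) - thetaSum (s ^ 12)) ^ (a - u) *
          (2 * thetaSum (s ^ 16) - thetaSum (s ^ 4)) ^ (b - v))))
      ((properChoose a b u v : ℝ) * (if 4 ∣ u + 3 * v then 1 else 0) +
        (properChoose a b u v : ℝ) * (if u = 0 ∧ v = 0 then 1 else 0))
      ((properChoose a b u v : ℝ) * ((if 4 ∣ u + 3 * v then 1 else 0) * (4 * v - 2 * b)) +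
        (properChoose a b u v : ℝ) * (signMod (u + 3 * v) * twistCoeff u v) +
        (properChoose a b u v : ℝ) * (if u = 0 ∧ v = 0 then (-2 * b : ℝ) else 0)) := by
    intro u _ v hv
    have hv : v ≤ b := by simpa [Nat.lt_succ_iff] using hv
    by_cases h4 : 4 ∣ u + 3 * v
    · have h := ((((hE.pow u).mul (hE'.pow v)).const_mul (((signMod (u + 3 * v) : ℤ) : ℝ) ^ 2)).add
        ((hasExpansion_twist h4).const_mul ((signMod (u + 3 * v) : ℤ) : ℝ))).mul
        ((hB.pow (a - u)).mul (hB'.pow (b - v))) |>.const_mul (properChoose a b u v : ℝ)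
      simp only [smul_eq_mul]
      refine h.congr ?_ ?_
      · by_cases h0 : u = 0 ∧ v = 0
        · obtain ⟨rfl, rfl⟩ := h0
          simp [signMod]; ring
        · rw [hs, signMod_sq, if_pos h4, if_neg h0]; ring
      · rw [Nat.cast_sub hv]
        by_cases h0 : u = 0 ∧ v = 0
        · obtain ⟨rfl, rfl⟩ := h0
          simp [signMod]; ring
        · rw [hs, signMod_sq, if_pos h4, if_neg h0, if_neg h0]; ring
    · have h0 : ((signMod (u + 3 * v) : ℤ) : ℝ) = 0 := by
        have := signMod_sq (u + 3 * v)
        rw [if_neg h4, ← hs] at this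
        exact pow_eq_zero_iff two_ne_zero |>.1 this
      have h00 : ¬ (u = 0 ∧ v = 0) := by
        rintro ⟨rfl, rfl⟩
        simp at h4
      rw [h0, if_neg h4, if_neg h00, if_neg h00]
      simpa using HasExpansion.const 0
  unfold restrictedForm
  refine (HasExpansion.sum _ fun u hu => HasExpansion.sum _ fun v hv => key u hu v hv).congr ?_ ?_
  · simp only [Finset.sum_add_distrib]
    rw [sum_properChoose_mul_ite hab, sum_properChoose_mul, if_pos hmod, chooseSum]
    ring
  · simp only [Finset.sum_add_distrib]
    rw [sum_properChoose_mul_ite hab, sum_properChoose_mul, if_pos hmod, chooseSum_symm hmod,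
      twistSum]
    ring

/-- The power series `f` converges absolutely at `q`, with value `v`. -/
def HasEval (q : ℝ) (f : PowerSeries ℝ) (v : ℝ) : Prop :=
  (Summable fun n => ‖PowerSeries.coeff n f * q ^ n‖) ∧
    HasSum (fun n => PowerSeries.coeff n f * q ^ n) v

namespace HasEval

variable {q v w : ℝ} {f g : PowerSeries ℝ}

theorem congr (h : HasEval q f v) (hv : v = w) : HasEval q f w := hv ▸ h

theorem add (hf : HasEval q f v) (hg : HasEval q g w) : HasEval q (f + g) (v + w) := by
  have h : ∀ n, PowerSeries.coeff n (f + g) * q ^ n =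
      PowerSeries.coeff n f * q ^ n + PowerSeries.coeff n g * q ^ n := fun n => by
    rw [map_add, add_mul]
  constructor
  · simp only [h]
    exact Summable.of_nonneg_of_le (fun _ => norm_nonneg _) (fun _ => norm_add_le _ _)
      (hf.1.add hg.1)
  · simpa only [h] using hf.2.add hg.2

theorem smul (hf : HasEval q f v) (k : ℝ) : HasEval q (k • f) (k • v) := by
  have h : ∀ n, PowerSeries.coeff n (k • f) * q ^ n =
      k * (PowerSeries.coeff n f * q ^ n) := fun n => by
    rw [map_smul, smul_eq_mul, mul_assoc]
  constructor
  · simp only [h, norm_mul k]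
    exact hf.1.mul_left _
  · simpa only [h, smul_eq_mul] using hf.2.mul_left k

theorem sub (hf : HasEval q f v) (hg : HasEval q g w) : HasEval q (f - g) (v - w) := by
  have := hf.add (hg.smul (-1))
  rwa [neg_one_smul, neg_one_smul, ← sub_eq_add_neg, ← sub_eq_add_neg] at this

theorem one : HasEval q 1 1 := by
  have h : ∀ n ≠ 0, PowerSeries.coeff n (1 : PowerSeries ℝ) * q ^ n = 0 := fun n hn => by
    simp [PowerSeries.coeff_one, hn]
  constructor
  · exact summable_of_ne_finset_zero (s := {0}) fun n hn => by
      rw [h n (by simpa using hn), norm_zero]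
  · simpa using hasSum_single 0 h

theorem mul (hf : HasEval q f v) (hg : HasEval q g w) : HasEval q (f * g) (v * w) := by
  have h : ∀ n, PowerSeries.coeff n (f * g) * q ^ n = ∑ kl ∈ antidiagonal n,
      (PowerSeries.coeff kl.1 f * q ^ kl.1) * (PowerSeries.coeff kl.2 g * q ^ kl.2) := fun n => by
    rw [PowerSeries.coeff_mul, Finset.sum_mul]
    refine Finset.sum_congr rfl fun kl hkl => ?_
    rw [← mem_antidiagonal.1 hkl, pow_add]
    ring
  have hs := summable_norm_sum_mul_antidiagonal_of_summable_norm hf.1 hg.1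
  constructor
  · simpa only [h] using hs
  · simp only [h]
    rw [← hf.2.tsum_eq, ← hg.2.tsum_eq,
      tsum_mul_tsum_eq_tsum_sum_antidiagonal_of_summable_norm hf.1 hg.1]
    exact hs.of_norm.hasSum

theorem pow (hf : HasEval q f v) (k : ℕ) : HasEval q (f ^ k) (v ^ k) := by
  induction k with
  | zero => simpa using one
  | succ k ih => rw [pow_succ, pow_succ]; exact ih.mul hf

theorem sum {ι : Type*} (t : Finset ι) {f : ι → PowerSeries ℝ} {v : ι → ℝ}
    (h : ∀ i ∈ t, HasEval q (f i) (v i)) : HasEval q (∑ i ∈ t, f i) (∑ i ∈ t, v i) := by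
  classical
  induction t using Finset.induction_on with
  | empty =>
    have := (one (q := q)).smul 0
    simpa using this
  | insert i t hi ih =>
    rw [Finset.sum_insert hi, Finset.sum_insert hi]
    exact (h i (Finset.mem_insert_self i t)).add
      (ih fun j hj => h j (Finset.mem_insert_of_mem hj))

theorem restrictedForm (a b : ℕ) {E E' D D' B B' : PowerSeries ℝ} {e e' d d' β β' : ℝ}
    (hE : HasEval q E e) (hE' : HasEval q E' e') (hD : HasEval q D d) (hD' : HasEval q D' d')
    (hB : HasEval q B β) (hB' : HasEval q B' β') :
    HasEval q (restrictedForm a b E E' D D' B B') (_root_.restrictedForm a b e e' d d' β β') :=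
  sum _ fun u _ => sum _ fun v _ => smul (mul (add (smul (mul (hE.pow u) (hE'.pow v)) _)
    (smul (mul (hD.pow u) (hD'.pow v)) _)) (mul (hB.pow (a - u)) (hB'.pow (b - v)))) _

end HasEval

theorem restrictedForm_mul (a b : ℕ) (l m e e' d d' β β' : ℝ) :
    restrictedForm a b (l * e) (m * e') (l * d) (m * d') (l * β) (m * β') =
      l ^ a * m ^ b * restrictedForm a b e e' d d' β β' := by
  unfold restrictedForm
  simp only [Finset.mul_sum, smul_eq_mul]
  refine Finset.sum_congr rfl fun u hu => Finset.sum_congr rfl fun v hv => ?_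
  have hu : u ≤ a := by simpa [Nat.lt_succ_iff] using hu
  have hv : v ≤ b := by simpa [Nat.lt_succ_iff] using hv
  have hl : l ^ a = l ^ u * l ^ (a - u) := by rw [← pow_add, Nat.add_sub_cancel' hu]
  have hm : m ^ b = m ^ v * m ^ (b - v) := by rw [← pow_add, Nat.add_sub_cancel' hv]
  rw [hl, hm]
  simp only [mul_pow]
  ring

theorem coeff_genSeries_mul_pow {X : Type*} {Q : X → ℕ} (h : FiniteFibers Q) (q : ℝ) (n : ℕ) :
    PowerSeries.coeff n (genSeries Q fun _ => 1) * q ^ n = ∑' x : Q ⁻¹' {n}, q ^ Q x := by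
  have : Finite (Q ⁻¹' {n}) := h n
  have := Fintype.ofFinite (Q ⁻¹' {n})
  have hx : ∀ x : Q ⁻¹' {n}, q ^ Q x = q ^ n := fun x => by rw [show Q x = n from x.2]
  simp only [hx, tsum_fintype, Finset.sum_const, Finset.card_univ, nsmul_eq_mul]
  congr 1
  have h1 := coeff_genSeries_indicator Q (fun _ => True) n
  simp only [if_true, true_and] at h1
  rw [h1, ← Nat.card_eq_fintype_card]
  rfl

theorem hasEval_genSeries {X : Type*} {Q : X → ℕ} (h : FiniteFibers Q) {q : ℝ} (hq : 0 ≤ q)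
    {v : ℝ} (hv : HasSum (fun x => q ^ Q x) v) : HasEval q (genSeries Q fun _ => 1) v := by
  have hs := hv.tsum_fiberwise Q
  simp only [← coeff_genSeries_mul_pow h] at hs
  refine ⟨?_, hs⟩
  refine hs.summable.congr fun n => (Real.norm_of_nonneg ?_).symm
  rw [coeff_genSeries_mul_pow h]
  exact tsum_nonneg fun x => pow_nonneg hq _

theorem hasEval_theta {c k : ℕ} (h : c * k = 48) {t : ℝ} (ht : 0 < t) :
    HasEval (Real.exp (-Real.pi * t)) (thetaSeries c)
      ((√(c * t))⁻¹ * thetaSum (Real.exp (-Real.pi / (48 * t)) ^ k)) := by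
  have hc : 0 < c := Nat.pos_of_ne_zero fun h0 => by simp [h0] at h
  have hct : 0 < c * t := by positivity
  have hx : Real.exp (-Real.pi * t) ^ c ∈ Set.Ico (0 : ℝ) 1 := by
    refine ⟨by positivity, pow_lt_one₀ (by positivity) ?_ hc.ne'⟩
    rw [Real.exp_lt_one_iff]
    nlinarith [Real.pi_pos]
  have hsum := (hasSum_thetaSum hx).summable.hasSum
  refine (hasEval_genSeries (finiteFibers_scaledSq hc) (Real.exp_nonneg _)
    (v := thetaSum (Real.exp (-Real.pi * t) ^ c)) ?_).congr ?_
  · simpa only [scaledSq, pow_mul, thetaSum] using hsum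
  · have := Real.tsum_exp_neg_mul_int_sq hct
    rw [Real.sqrt_eq_rpow, thetaSum, thetaSum, inv_eq_one_div]
    convert this using 2
    · ext n
      rw [← Real.exp_nat_mul, ← Real.exp_nat_mul]
      congr 1
      push_cast
      rw [Nat.cast_natAbs, Int.cast_abs, sq_abs]
      ring
    · congr 1
      ext n
      rw [← Real.exp_nat_mul, ← Real.exp_nat_mul]
      congr 1
      push_cast
      rw [Nat.cast_natAbs, Int.cast_abs, sq_abs]
      have : (k : ℝ) = 48 / c := by
        rw [eq_div_iff (by positivity), mul_comm]; exact_mod_cast h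
      rw [this]
      field_simp

theorem hasEval_even {c k : ℕ} (h : c * 4 * k = 48) {t : ℝ} (ht : 0 < t) :
    HasEval (Real.exp (-Real.pi * t)) (evenSeries c)
      ((√(4 * c * t))⁻¹ * thetaSum (Real.exp (-Real.pi / (48 * t)) ^ k)) := by
  have := hasEval_theta (c := 4 * c) (k := k) (by rw [← h]; ring) ht
  rw [even_eq_theta]
  push_cast at this
  exact this

theorem sqrt_four_mul_inv (x : ℝ) : (√(4 * x))⁻¹ = 2⁻¹ * (√x)⁻¹ := by
  rw [Real.sqrt_mul (by norm_num), show (4 : ℝ) = 2 ^ 2 by norm_num, Real.sqrt_sq (by norm_num),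
    mul_inv]

theorem hasEval_odd {c k : ℕ} (hc : 0 < c) (h : c * 4 * k = 48) {t : ℝ} (ht : 0 < t) :
    HasEval (Real.exp (-Real.pi * t)) (oddSeries c)
      ((√(4 * c * t))⁻¹ * (2 * thetaSum (Real.exp (-Real.pi / (48 * t)) ^ (4 * k)) -
        thetaSum (Real.exp (-Real.pi / (48 * t)) ^ k))) := by
  have := (hasEval_theta (c := c) (k := 4 * k) (by rw [← h]; ring) ht).sub (hasEval_even h ht)
  rw [← even_add_odd hc, add_sub_cancel_left] at this
  refine this.congr ?_
  rw [mul_assoc 4, sqrt_four_mul_inv]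
  ring

theorem hasEval_twist {c k : ℕ} (hc : 0 < c) (h : c * 16 * k = 48) {t : ℝ} (ht : 0 < t) :
    HasEval (Real.exp (-Real.pi * t)) (twistSeries c)
      ((√(4 * c * t))⁻¹ * (thetaSum (Real.exp (-Real.pi / (48 * t)) ^ k) -
        thetaSum (Real.exp (-Real.pi / (48 * t)) ^ (4 * k)))) := by
  have := ((hasEval_theta (c := 16 * c) (k := k) (by rw [← h]; ring) ht).smul 2).sub
    (hasEval_even (c := c) (k := 4 * k) (by rw [← h]; ring) ht)
  have h2 : (2 : ℝ) • thetaSeries (16 * c) = 2 * thetaSeries (16 * c) := by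
    rw [Algebra.smul_def, map_ofNat]
  rw [h2, ← twist_add_even hc, add_sub_cancel_right] at this
  refine this.congr ?_
  push_cast
  rw [show (16 : ℝ) * c * t = 4 * (4 * c * t) by ring, sqrt_four_mul_inv, smul_eq_mul]
  ring

/-- Modularity of the theta constants, applied to the restricted form. -/
theorem hasEval_restrictedForm_sub (a b : ℕ) (K : ℝ) {t : ℝ} (ht : 0 < t) {s : ℝ}
    (hs : s = Real.exp (-Real.pi / (48 * t))) :
    HasEval (Real.exp (-Real.pi * t)) (restrictedForm a b (evenSeries 1) (evenSeries 3)
      (twistSeries 1) (twistSeries 3) (oddSeries 1) (oddSeries 3) -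
        K • (oddSeries 1 ^ a * oddSeries 3 ^ b))
      ((√(4 * t))⁻¹ ^ a * (√(12 * t))⁻¹ ^ b *
        (restrictedForm a b (thetaSum (s ^ 12)) (thetaSum (s ^ 4))
      (thetaSum (s ^ 3) - thetaSum (s ^ 12)) (thetaSum (s ^ 1) - thetaSum (s ^ 4))
      (2 * thetaSum (s ^ 48) - thetaSum (s ^ 12)) (2 * thetaSum (s ^ 16) - thetaSum (s ^ 4)) -
        K * ((2 * thetaSum (s ^ 48) - thetaSum (s ^ 12)) ^ a *
          (2 * thetaSum (s ^ 16) - thetaSum (s ^ 4)) ^ b))) := by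
  subst hs
  have hE := hasEval_even (c := 1) (k := 12) (by norm_num) ht
  have hE' := hasEval_even (c := 3) (k := 4) (by norm_num) ht
  have hD := hasEval_twist (c := 1) (k := 3) one_pos (by norm_num) ht
  have hD' := hasEval_twist (c := 3) (k := 1) three_pos (by norm_num) ht
  have hB := hasEval_odd (c := 1) (k := 12) one_pos (by norm_num) ht
  have hB' := hasEval_odd (c := 3) (k := 4) three_pos (by norm_num) ht
  refine ((HasEval.restrictedForm a b hE hE' hD hD' hB hB').sub
    (((hB.pow a).mul (hB'.pow b)).smul K)).congr ?_
  rw [restrictedForm_mul, smul_eq_mul, mul_pow, mul_pow]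
  norm_num
  ring

open Filter Topology in
theorem two_mul_chooseSum_eq {a b : ℕ} (hab : 0 < a + b) (hmod : 4 ∣ a + 3 * b) {K : ℝ} {m : ℕ}
    (h0 : ∀ n, 0 ≤ PowerSeries.coeff n (restrictedForm a b (evenSeries 1) (evenSeries 3)
      (twistSeries 1) (twistSeries 3) (oddSeries 1) (oddSeries 3) -
        K • (oddSeries 1 ^ a * oddSeries 3 ^ b)))
    (hm : ∀ n, m ≤ n → PowerSeries.coeff n (restrictedForm a b (evenSeries 1) (evenSeries 3)
      (twistSeries 1) (twistSeries 3) (oddSeries 1) (oddSeries 3) -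
        K • (oddSeries 1 ^ a * oddSeries 3 ^ b)) = 0) :
    2 * b * chooseSum a b = 4 * b - twistSum a b := by
  have heval := fun t (ht : 0 < t) => hasEval_restrictedForm_sub a b K ht rfl
  set P := restrictedForm a b (evenSeries 1) (evenSeries 3)
      (twistSeries 1) (twistSeries 3) (oddSeries 1) (oddSeries 3) -
        K • (oddSeries 1 ^ a * oddSeries 3 ^ b)
  set G : ℝ → ℝ := fun s => restrictedForm a b (thetaSum (s ^ 12)) (thetaSum (s ^ 4))
      (thetaSum (s ^ 3) - thetaSum (s ^ 12)) (thetaSum (s ^ 1) - thetaSum (s ^ 4))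
      (2 * thetaSum (s ^ 48) - thetaSum (s ^ 12)) (2 * thetaSum (s ^ 16) - thetaSum (s ^ 4)) -
        K * ((2 * thetaSum (s ^ 48) - thetaSum (s ^ 12)) ^ a *
          (2 * thetaSum (s ^ 16) - thetaSum (s ^ 4)) ^ b) with hG
  set p : ℝ → ℝ := fun q => ∑ n ∈ range m, PowerSeries.coeff n P * q ^ n
  set S : ℝ → ℝ := fun t => Real.exp (-Real.pi / (48 * t))
  set L : ℝ → ℝ := fun t => √(4 * t) ^ a * √(12 * t) ^ b with hL
  have hpcont : Continuous p := by fun_prop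
  have hGp : ∀ t, 0 < t → G (S t) = L t * p (Real.exp (-Real.pi * t)) := by
    intro t ht
    have h1 := (heval t ht).2.unique (hasSum_sum_of_ne_finset_zero (s := range m) fun n hn => by
      rw [hm n (by simpa using hn), zero_mul])
    have h4 : √(4 * t) ≠ 0 := by positivity
    have h12 : √(12 * t) ≠ 0 := by positivity
    change (√(4 * t))⁻¹ ^ a * (√(12 * t))⁻¹ ^ b * G (S t) = p (Real.exp (-Real.pi * t)) at h1
    rw [← h1, hL, inv_pow, inv_pow]
    field_simp
  have hexp : HasExpansion G (chooseSum a b - K) (twistSum a b - 4 * b + 2 * b * K) := by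
    have hB : HasExpansion (fun s => 2 * thetaSum (s ^ 48) - thetaSum (s ^ 12)) 1 0 :=
      (((hasExpansion_thetaSum_of_lt (by norm_num)).const_mul 2).sub
        (hasExpansion_thetaSum_of_lt (by norm_num))).congr (by norm_num) (by norm_num)
    have hB' : HasExpansion (fun s => 2 * thetaSum (s ^ 16) - thetaSum (s ^ 4)) 1 (-2) :=
      (((hasExpansion_thetaSum_of_lt (by norm_num)).const_mul 2).sub
        hasExpansion_thetaSum_four).congr (by norm_num) (by norm_num)
    exact ((hasExpansion_restrictedForm hab hmod).sub
      (((hB.pow a).mul (hB'.pow b)).const_mul K)).congr (by ring) (by ring)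
  have hxt : Tendsto (fun t : ℝ => t⁻¹) (𝓝[>] 0) atTop := tendsto_inv_nhdsGT_zero
  have hS : Tendsto S (𝓝[>] 0) (𝓝[>] 0) := by
    refine tendsto_nhdsWithin_iff.2 ⟨?_, Eventually.of_forall fun t => Real.exp_pos _⟩
    refine Real.tendsto_exp_atBot.comp ?_
    have := hxt.const_mul_atTop_of_neg (show -Real.pi / 48 < 0 by
      linarith [Real.pi_pos])
    refine this.congr fun t => ?_
    rw [div_mul_eq_div_div, div_eq_mul_inv _ t]
  have hp1 : Tendsto (fun t => p (Real.exp (-Real.pi * t))) (𝓝[>] 0) (𝓝 (p 1)) := by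
    have : Tendsto (fun t => p (Real.exp (-Real.pi * t))) (𝓝 0)
        (𝓝 (p (Real.exp (-Real.pi * 0)))) := Continuous.tendsto (by fun_prop) 0
    rw [mul_zero, Real.exp_zero] at this
    exact this.mono_left nhdsWithin_le_nhds
  have hL0 : Tendsto L (𝓝[>] 0) (𝓝 0) := by
    have : Tendsto L (𝓝 0) (𝓝 (L 0)) := Continuous.tendsto (by fun_prop) 0
    have hz : L 0 = 0 := by
      simp only [hL, mul_zero, Real.sqrt_zero]
      rw [← pow_add, zero_pow hab.ne']
    rw [hz] at this
    exact this.mono_left nhdsWithin_le_nhds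
  have hGS : (fun t => L t * p (Real.exp (-Real.pi * t))) =ᶠ[𝓝[>] 0] fun t => G (S t) := by
    filter_upwards [self_mem_nhdsWithin] with t ht using (hGp t ht).symm
  have hK : chooseSum a b = K := by
    have h1 := hexp.tendsto.comp hS
    have h2 := (hL0.mul hp1).congr' hGS
    rw [zero_mul] at h2
    linarith [tendsto_nhds_unique h1 h2]
  have hSL : Tendsto (fun t => S t ^ 4 / L t) (𝓝[>] 0) (𝓝 0) := by
    have h1 := (Real.tendsto_pow_mul_exp_neg_atTop_nhds_zero (a + b)).comp
      ((hxt.const_mul_atTop (show 0 < Real.pi / 12 by positivity)))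
    have h2 := h1.mul_const ((12 / Real.pi) ^ (a + b))
    rw [zero_mul] at h2
    refine squeeze_zero' ?_ ?_ h2
    · exact Eventually.of_forall fun t => by positivity
    · filter_upwards [Ioo_mem_nhdsGT one_pos] with t ht
      have ht0 := ht.1
      have e1 : S t ^ 4 = Real.exp (-(Real.pi / 12 * t⁻¹)) := by
        rw [← Real.exp_nat_mul]
        congr 1
        push_cast
        field_simp
        ring
      have e2 : t ^ (a + b) ≤ L t := by
        rw [pow_add]
        have h1 : t ≤ √(4 * t) := Real.le_sqrt_of_sq_le (by nlinarith [ht.2])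
        have h2 : t ≤ √(12 * t) := Real.le_sqrt_of_sq_le (by nlinarith [ht.2])
        exact mul_le_mul (pow_le_pow_left₀ ht0.le h1 a) (pow_le_pow_left₀ ht0.le h2 b)
          (by positivity) (by positivity)
      rw [e1]
      calc _ ≤ Real.exp (-(Real.pi / 12 * t⁻¹)) / t ^ (a + b) :=
            div_le_div_of_nonneg_left (Real.exp_nonneg _) (by positivity) e2
        _ = _ := by
            simp only [Function.comp_apply, mul_pow, div_pow, inv_pow]
            field_simp
  have hp0 : p 1 = 0 := by
    have hexp' := hexp
    rw [hK, sub_self] at hexp'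
    have h1 := (Tendsto.comp hexp' hS).mul hSL
    rw [mul_zero] at h1
    refine tendsto_nhds_unique hp1 (h1.congr' ?_)
    filter_upwards [self_mem_nhdsWithin] with t ht
    have ht : 0 < t := ht
    have hs4 : S t ≠ 0 := (Real.exp_pos _).ne'
    have hLt : L t ≠ 0 := by
      have h4 : √(4 * t) ≠ 0 := by positivity
      have h12 : √(12 * t) ≠ 0 := by positivity
      exact mul_ne_zero (pow_ne_zero _ h4) (pow_ne_zero _ h12)
    simp only [Function.comp_apply, sub_zero]
    rw [hGp t ht]
    field_simp
  have hpz : ∀ q, p q = 0 := by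
    intro q
    have h1 : ∑ n ∈ range m, PowerSeries.coeff n P = 0 := by simpa [p] using hp0
    rw [Finset.sum_eq_zero_iff_of_nonneg fun n _ => h0 n] at h1
    exact Finset.sum_eq_zero fun n hn => by rw [h1 n hn, zero_mul]
  have hder := Tendsto.comp hexp hS
  have hzero : Tendsto (fun _ : ℝ => (0 : ℝ)) (𝓝[>] 0)
      (𝓝 (twistSum a b - 4 * b + 2 * b * K)) := by
    refine hder.congr' ?_
    filter_upwards [self_mem_nhdsWithin] with t ht
    simp [hGp t ht, hpz, hK]
  have := tendsto_nhds_unique hzero tendsto_const_nhds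
  rw [hK]
  linarith

theorem Nstar_eq_zero_of_lt {a b n : ℕ} (h : n < a + 3 * b) : Nstar a b n = 0 := by
  refine (congrArg Set.ncard ?_).trans (Set.ncard_empty ((Fin a → ℤ) × (Fin b → ℤ)))
  ext p
  simp only [Set.mem_ofPred_eq, Set.mem_empty_iff_false, iff_false, not_and]
  intro h1 h2 h3
  have hsq : ∀ x : ℤ, Odd x → 1 ≤ x ^ 2 := fun x hx => by
    have : x ≠ 0 := by rintro rfl; simp at hx
    have := sq_pos_of_ne_zero this
    omega
  have h4 := Finset.card_nsmul_le_sum univ (fun i => p.1 i ^ 2) 1 fun i _ => hsq _ (h1 i)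
  have h5 := Finset.card_nsmul_le_sum univ (fun i => p.2 i ^ 2) 1 fun i _ => hsq _ (h2 i)
  simp only [Finset.card_univ, Fintype.card_fin, nsmul_eq_mul, mul_one] at h4 h5
  omega

theorem oddSeries_ne_zero {c : ℕ} (hc : 0 < c) : oddSeries c ≠ 0 := by
  intro h
  have h1 := coeff_genSeries_indicator (scaledSq c) Odd c
  rw [show genSeries (scaledSq c) (fun x => if Odd x then 1 else 0) = oddSeries c from rfl, h,
    map_zero, eq_comm, Nat.cast_eq_zero] at h1
  exact Set.ncard_ne_zero_of_mem (a := (1 : ℤ)) (by simp [scaledSq])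
    ((finiteFibers_scaledSq hc c).subset fun x hx => hx.2) h1

theorem mem_of_exists_const {a b : ℕ} (hb : 0 < b) (hpar : Even (a + b)) (hmod : 4 ∣ a + 3 * b)
    {C : ℚ} (hC : ∀ n : ℕ, (Nstar a b (8 * (n : ℤ) + a + 3 * b) : ℚ)
      = C * (Ntilde a b (8 * (n : ℤ) + a + 3 * b) : ℚ)) :
    (a, b) ∈ ({(0, 4), (0, 8), (1, 1), (1, 5), (2, 2), (4, 0), (5, 1), (8, 0)} :
        Set (ℕ × ℕ)) := by
  have hsupp : ∀ n : ℕ, Nstar a b n ≠ 0 →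
      (n : ZMod 8) = a + 3 * b ∧ ∃ k : ℕ, (n : ℤ) = 8 * k + a + 3 * b := by
    intro n hn
    have h1 := ((supportedMod_oddSeries 1).pow a).mul ((supportedMod_oddSeries 3).pow b) n
      (by rw [coeff_odd]; exact_mod_cast hn)
    have h2 : (n : ZMod 8) = a + 3 * b := by
      rw [h1]; push_cast; ring
    refine ⟨h2, ?_⟩
    have h3 : a + 3 * b ≤ n := by
      by_contra h
      exact hn (Nstar_eq_zero_of_lt (by omega))
    have h4 : n ≡ a + 3 * b [MOD 8] := by
      rw [← ZMod.natCast_eq_natCast_iff, h2]; push_cast; rfl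
    obtain ⟨k, hk⟩ := (Nat.modEq_iff_dvd' h3).1 h4.symm
    exact ⟨k, by omega⟩
  have hC0 : C ≠ 0 := by
    rintro rfl
    have h0 : oddSeries 1 ^ a * oddSeries 3 ^ b = 0 := by
      ext n
      rw [coeff_odd, map_zero, Nat.cast_eq_zero]
      by_contra hn
      obtain ⟨-, k, hk⟩ := hsupp n hn
      have := hC k
      rw [← hk, zero_mul] at this
      exact hn (by exact_mod_cast this)
    exact mul_ne_zero (pow_ne_zero _ (oddSeries_ne_zero one_pos))
      (pow_ne_zero _ (oddSeries_ne_zero three_pos)) h0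
  have hcoeff : ∀ n, PowerSeries.coeff n (restrictedForm a b (evenSeries 1) (evenSeries 3)
      (twistSeries 1) (twistSeries 3) (oddSeries 1) (oddSeries 3) -
        (2 / C : ℝ) • (oddSeries 1 ^ a * oddSeries 3 ^ b)) =
      if (n : ZMod 8) = a + 3 * b ∧ n < a + 3 * b then 2 * (Ntilde a b n : ℝ) else 0 := by
    intro n
    rw [map_sub, map_smul, coeff_restrictedForm, coeff_odd, smul_eq_mul]
    by_cases h1 : (n : ZMod 8) = a + 3 * b
    · by_cases h2 : n < a + 3 * b
      · rw [if_pos h1, if_pos ⟨h1, h2⟩, Nstar_eq_zero_of_lt h2]; simp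
      · rw [if_pos h1, if_neg fun h => h2 h.2]
        have h4 : n ≡ a + 3 * b [MOD 8] := by
          rw [← ZMod.natCast_eq_natCast_iff, h1]; push_cast; rfl
        obtain ⟨k, hk⟩ := (Nat.modEq_iff_dvd' (by omega)).1 h4.symm
        have hn : (n : ℤ) = 8 * k + a + 3 * b := by omega
        have := hC k
        rw [← hn] at this
        have h3 : (Nstar a b n : ℝ) = C * Ntilde a b n := by exact_mod_cast this
        have hC' : (C : ℝ) ≠ 0 := by exact_mod_cast hC0
        rw [h3]
        field_simp
        ring
    · have h2 : Nstar a b n = 0 := by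
        by_contra h
        exact h1 (hsupp n h).1
      rw [if_neg h1, if_neg fun h => h1 h.1, h2]; simp
  have h := two_mul_chooseSum_eq (a := a) (b := b) (K := (2 / C : ℝ)) (m := a + 3 * b) (by omega)
    hmod
    (fun n => by
      rw [hcoeff]
      have : (0 : ℝ) ≤ Ntilde a b n := by exact_mod_cast Ntilde_nonneg a b n
      split_ifs <;> positivity)
    (fun n hn => by rw [hcoeff, if_neg fun h => by omega])
  refine mem_of_chooseSum_le hb hpar hmod ?_
  linarith [le_twistSum a b]

theorem N_three_mul (a : ℕ) (n : ℤ) : N 0 a (3 * n) = N a 0 n := by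
  refine Set.ncard_congr (fun p _ => (p.2, p.1)) ?_ ?_ ?_
  · rintro ⟨x, y⟩ h
    simp at h ⊢
    linarith
  · rintro ⟨x, y⟩ ⟨x', y'⟩ _ _ h
    simp only [Prod.mk.injEq] at h ⊢
    exact ⟨h.2, h.1⟩
  · rintro ⟨x, y⟩ h
    refine ⟨(y, x), ?_, rfl⟩
    simp at h ⊢
    linarith

theorem Nstar_three_mul (a : ℕ) (n : ℤ) : Nstar 0 a (3 * n) = Nstar a 0 n := by
  refine Set.ncard_congr (fun p _ => (p.2, p.1)) ?_ ?_ ?_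
  · rintro ⟨x, y⟩ h
    simp at h ⊢
    exact ⟨h.1, by linarith [h.2]⟩
  · rintro ⟨x, y⟩ ⟨x', y'⟩ _ _ h
    simp only [Prod.mk.injEq] at h ⊢
    exact ⟨h.2, h.1⟩
  · rintro ⟨x, y⟩ h
    refine ⟨(y, x), ?_, rfl⟩
    simp at h ⊢
    exact ⟨h.1, by linarith [h.2]⟩

theorem Ntilde_three_mul (a : ℕ) (n : ℤ) : Ntilde 0 a (3 * n) = Ntilde a 0 n := by
  have h4 : (4 : ℤ) ∣ 3 * n ↔ 4 ∣ n := by omega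
  simp only [Ntilde, N_three_mul, h4]
  by_cases h : (4 : ℤ) ∣ n
  · rw [if_pos h, if_pos h, ← N_three_mul a (n / 4), show 3 * n / 4 = 3 * (n / 4) by omega]
  · rw [if_neg h, if_neg h]

theorem N_zero_eq_zero {a : ℕ} {n : ℤ} (h : ¬ 3 ∣ n) : N 0 a n = 0 := by
  refine (congrArg Set.ncard ?_).trans (Set.ncard_empty ((Fin 0 → ℤ) × (Fin a → ℤ)))
  ext p
  simp only [Set.mem_ofPred_eq, Set.mem_empty_iff_false, iff_false]
  intro h1
  simp at h1
  omega

theorem Nstar_zero_eq_zero {a : ℕ} {n : ℤ} (h : ¬ 3 ∣ n) : Nstar 0 a n = 0 := by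
  refine (congrArg Set.ncard ?_).trans (Set.ncard_empty ((Fin 0 → ℤ) × (Fin a → ℤ)))
  ext p
  simp only [Set.mem_ofPred_eq, Set.mem_empty_iff_false, iff_false, not_and]
  intro _ _ h1
  simp at h1
  omega

theorem exists_const_swap {a : ℕ} {C : ℚ} (hC : ∀ n : ℕ, (Nstar a 0 (8 * (n : ℤ) + a) : ℚ)
    = C * (Ntilde a 0 (8 * (n : ℤ) + a) : ℚ)) (n : ℕ) :
    (Nstar 0 a (8 * (n : ℤ) + 3 * a) : ℚ) = C * (Ntilde 0 a (8 * (n : ℤ) + 3 * a) : ℚ) := by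
  by_cases h : 3 ∣ n
  · obtain ⟨k, rfl⟩ := h
    rw [show 8 * ((3 * k : ℕ) : ℤ) + 3 * a = 3 * (8 * k + a) by push_cast; ring,
      Nstar_three_mul, Ntilde_three_mul, hC]
  · have h1 : ¬ (3 : ℤ) ∣ 8 * n + 3 * a := by omega
    have h2 : (4 : ℤ) ∣ 8 * n + 3 * a → N 0 a ((8 * (n : ℤ) + 3 * a) / 4) = 0 := fun h4 =>
      N_zero_eq_zero (by omega)
    rw [Nstar_zero_eq_zero h1, Ntilde, N_zero_eq_zero h1]
    split_ifs with h4
    · simp [h2 h4]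
    · simp

end

theorem stmt_1 (a b : ℕ) (hab : (a, b) ≠ (0, 0)) (hpar : Even (a + b))
    (hmod : 4 ∣ a + 3 * b) :
    (∃ C : ℚ, ∀ n : ℕ,
        (Nstar a b (8 * (n : ℤ) + a + 3 * b) : ℚ)
          = C * (Ntilde a b (8 * (n : ℤ) + a + 3 * b) : ℚ)) ↔
      (a, b) ∈ ({(0, 4), (0, 8), (1, 1), (1, 5), (2, 2), (4, 0), (5, 1), (8, 0)} :
        Set (ℕ × ℕ)) := by
  constructor
  · rintro ⟨C, hC⟩
    rcases Nat.eq_zero_or_pos b with rfl | hb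
    · have ha : 0 < a := Nat.pos_of_ne_zero fun h => hab (by rw [h])
      have h := mem_of_exists_const (a := 0) (b := a) (C := C) ha (by simpa using hpar)
        (by omega) (by
          have := exists_const_swap (a := a) (C := C) (by simpa using hC)
          simpa using this)
      have h' : a = 4 ∨ a = 8 := by simpa using h
      rcases h' with rfl | rfl <;> simp
    · exact mem_of_exists_const hb hpar hmod hC
  · exact exists_const_of_mem
end
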